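/- Let F be a field of characteristic 2 and E = F(b_1^{1/2^{m_1}},…,b_r^{1/2^{m_r}}) a purely inseparable extension with 2-independent b_1,…,b_r ∈ F and integers m_1,…,m_r ≥ 1. Then ν_1(E/F) = { dx/x : x ∈ F²(b_1,…,b_r)^* } (and this set already is an additive group), and for all n ≥ 1, ν_n(E/F) = ν_1(E/F) ∧ ν_{n-1}(F). -/

import Mathlib

noncomputable section

/-- The full algebra of absolute differential forms of a field `F`:
the exterior algebra of the `F`-module of absolute Kähler differentials `Ω[F⁄ℤ]`. -/
abbrev DF (F : Type*) [Field F] : Type _ :=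
  ExteriorAlgebra F (KaehlerDifferential ℤ F)

/-- `Ω_F^n`, the space of differential `n`-forms, as a submodule of `DF F`. -/
def omegaPow (F : Type*) [Field F] (n : ℕ) : Submodule F (DF F) :=
  LinearMap.range (ExteriorAlgebra.ι F :
    KaehlerDifferential ℤ F →ₗ[F] DF F) ^ n

/-- `Ω_F^{n-1}`, with the convention `Ω_F^{-1} = 0`. -/
def omegaPred (F : Type*) [Field F] : ℕ → Submodule F (DF F)
  | 0 => ⊥
  | n + 1 => omegaPow F n

/-- The exact 1-form `d a` of an element `a ∈ F`. -/
def dForm (F : Type*) [Field F] (a : F) : DF F :=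
  ExteriorAlgebra.ι F (KaehlerDifferential.D ℤ F a)

/-- The logarithmic 1-form `da/a` of an element `a ∈ F`. -/
def dLog (F : Type*) [Field F] (a : F) : DF F :=
  ExteriorAlgebra.ι F (a⁻¹ • KaehlerDifferential.D ℤ F a)

/-- The logarithmic `n`-form `(dx₁/x₁) ∧ … ∧ (dxₙ/xₙ)`. -/
def logForm (F : Type*) [Field F] {n : ℕ} (x : Fin n → F) : DF F :=
  (List.ofFn fun i => dLog F (x i)).prod

/-- The exterior derivative `d` together with the (`p`-basis dependent) additive map `s_p`
on the differential forms of a field `F` of characteristic `p`. -/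
structure DiffStr (p : ℕ) (F : Type*) [Field F] where
  d : DF F →+ DF F
  sp : DF F →+ DF F
  d_grade : ∀ n : ℕ, ∀ ω ∈ omegaPow F n, d ω ∈ omegaPow F (n + 1)
  d_d : ∀ ω : DF F, d (d ω) = 0
  d_one : d 1 = 0
  d_smul : ∀ (a : F) (ω : DF F), d (a • ω) = dForm F a * ω + a • d ω
  sp_grade : ∀ n : ℕ, ∀ ω ∈ omegaPow F n, sp ω ∈ omegaPow F n
  sp_log : ∀ (n : ℕ) (a : F) (x : Fin n → F),
      ∃ η ∈ omegaPred F n, sp (a • logForm F x) = a ^ p • logForm F x + d η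

/-- The Artin–Schreier map `℘ = s_p − id` on differential forms. -/
def asMap {p : ℕ} {F : Type*} [Field F] (S : DiffStr p F) : DF F →+ DF F :=
  S.sp - AddMonoidHom.id (DF F)

/-- The subgroup `℘Ω_F^n + dΩ_F^{n-1}` of `Ω_F^n`; the group `H_p^{n+1}(F)` is the quotient
of `Ω_F^n` by this subgroup. -/
def hRel {p : ℕ} {F : Type*} [Field F] (S : DiffStr p F) (n : ℕ) : AddSubgroup (DF F) :=
  ((omegaPow F n).toAddSubgroup.map (asMap S)) ⊔ ((omegaPred F n).toAddSubgroup.map S.d)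

/-- The `t`-th iterate `v ↦ v^{[p^t]}` of the map `s_p`. -/
def spIter {p : ℕ} {F : Type*} [Field F] (S : DiffStr p F) (t : ℕ) : DF F → DF F :=
  (fun x => S.sp x)^[t]

/-- `ν_n(F) = ker(℘ : Ω_F^n → Ω_F^n/dΩ_F^{n-1})`. -/
def nuSet {p : ℕ} {F : Type*} [Field F] (S : DiffStr p F) (n : ℕ) : Set (DF F) :=
  { η | η ∈ omegaPow F n ∧ ∃ z ∈ omegaPred F n, S.sp η - η = S.d z }

/-- Restriction of differential forms along a field extension `E/F`. -/
structure DiffRes (p : ℕ) (F E : Type*) [Field F] [Field E] [Algebra F E]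
    (SF : DiffStr p F) (SE : DiffStr p E) where
  res : DF F →+ DF E
  res_one : res 1 = 1
  res_mul : ∀ x y : DF F, res (x * y) = res x * res y
  res_smul : ∀ (a : F) (ω : DF F), res (a • ω) = algebraMap F E a • res ω
  res_dForm : ∀ a : F, res (dForm F a) = dForm E (algebraMap F E a)
  res_grade : ∀ n : ℕ, ∀ ω ∈ omegaPow F n, res ω ∈ omegaPow E n
  res_d : ∀ ω : DF F, res (SF.d ω) = SE.d (res ω)

/-- `2`-independence of `b₁,…,b_r ∈ F`: `[F²(b₁,…,b_r) : F²] = 2^r`, expressed as the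
linear independence over `F²` of the `2^r` monomials `∏ bᵢ^{eᵢ}`, `0 ≤ eᵢ < 2`. -/
def TwoIndep {F : Type*} [Field F] {r : ℕ} (b : Fin r → F) : Prop :=
  ∀ c : (Fin r → Fin 2) → F,
    (∑ e : Fin r → Fin 2, c e ^ 2 * ∏ i, b i ^ (e i : ℕ)) = 0 → ∀ e, c e = 0

/-- The subfield `F²(b₁,…,b_r)` of `F` generated by the squares and `b₁,…,b_r`. -/
def sqSubfield {F : Type*} [Field F] {r : ℕ} (b : Fin r → F) : Subfield F :=
  Subfield.closure (Set.range (fun y : F => y ^ 2) ∪ Set.range b)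

/-! ### Part 1: the exterior algebra in characteristic two -/

lemma basis_ind {K V J : Type*} [Field K] [AddCommGroup V] [Module K V]
    (bs : Module.Basis J K V) {p : V → Prop} (zero : p 0) (add : ∀ a b, p a → p b → p (a + b))
    (smul : ∀ (c : K) a, p a → p (c • a)) (basis : ∀ j, p (bs j)) (x : V) : p x := by
  have hx : x ∈ Submodule.span K (Set.range bs) := by rw [bs.span_eq]; trivial
  induction hx using Submodule.span_induction with
  | mem y hy => obtain ⟨j, rfl⟩ := hy; exact basis j
  | zero => exact zero
  | add a b _ _ ha hb => exact add a b ha hb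
  | smul c a _ ha => exact smul c a ha

set_option linter.unusedSectionVars false

section ExtTwo
variable {K V J : Type*} [Field K] [CharP K 2] [AddCommGroup V] [Module K V] [DecidableEq J]

lemma ext_add_self (x : ExteriorAlgebra K V) : x + x = 0 := by
  have h : (2 : K) • x = 0 := by rw [CharTwo.two_eq_zero, zero_smul]
  rwa [two_smul] at h

lemma ext_neg (x : ExteriorAlgebra K V) : -x = x :=
  neg_eq_of_add_eq_zero_left (ext_add_self x)

lemma ext_sub (x y : ExteriorAlgebra K V) : x - y = x + y := by
  rw [sub_eq_add_neg, ext_neg]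

lemma ext_comm (v w : V) :
    Commute (ExteriorAlgebra.ι K v) (ExteriorAlgebra.ι K w) := by
  have h := ExteriorAlgebra.ι_add_mul_swap (R := K) v w
  have := eq_neg_of_add_eq_zero_left h
  rw [ext_neg] at this
  exact this

/-- The wedge product of the family `v` over the finite set `s`. -/
def eF (K : Type*) {V J : Type*} [Field K] [CharP K 2] [AddCommGroup V] [Module K V]
    (v : J → V) (s : Finset J) : ExteriorAlgebra K V :=
  s.noncommProd (fun j => ExteriorAlgebra.ι K (v j)) (fun _ _ _ _ _ => ext_comm _ _)

@[simp] lemma eF_empty (v : J → V) : eF K v ∅ = 1 := Finset.noncommProd_empty _ _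

lemma eF_insert (v : J → V) (s : Finset J) (j : J) (h : j ∉ s) :
    eF K v (insert j s) = ExteriorAlgebra.ι K (v j) * eF K v s :=
  Finset.noncommProd_insert_of_notMem s j _ _ h

lemma eF_insert' (v : J → V) (s : Finset J) (j : J) (h : j ∉ s) :
    eF K v (insert j s) = eF K v s * ExteriorAlgebra.ι K (v j) :=
  Finset.noncommProd_insert_of_notMem' s j _ _ h

lemma ι_mul_eF_mem (v : J → V) (s : Finset J) (j : J) (h : j ∈ s) :
    ExteriorAlgebra.ι K (v j) * eF K v s = 0 := by
  rw [← Finset.insert_erase h, eF_insert _ _ _ (Finset.notMem_erase _ _), ← mul_assoc,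
    ExteriorAlgebra.ι_sq_zero, zero_mul]

lemma ι_comm_eF (v : J → V) (s : Finset J) (w : V) :
    ExteriorAlgebra.ι K w * eF K v s = eF K v s * ExteriorAlgebra.ι K w := by
  induction s using Finset.induction_on with
  | empty => simp
  | insert j s hj ih =>
    rw [eF_insert _ _ _ hj, ← mul_assoc, (ext_comm w (v j)).eq, mul_assoc, ih, mul_assoc]

lemma ι_mul_eF (v : J → V) (s : Finset J) (j : J) :
    ExteriorAlgebra.ι K (v j) * eF K v s = if j ∈ s then 0 else eF K v (insert j s) := by
  split_ifs with h
  · exact ι_mul_eF_mem v s j h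
  · rw [eF_insert _ _ _ h]

lemma eF_zero (v : J → V) (s : Finset J) (j : J) (h : j ∈ s) (hv : v j = 0) : eF K v s = 0 := by
  rw [← Finset.insert_erase h, eF_insert _ _ _ (Finset.notMem_erase _ _), hv, map_zero, zero_mul]

/-- contraction with a dual vector -/
def contr (f : Module.Dual K V) : ExteriorAlgebra K V →ₗ[K] ExteriorAlgebra K V :=
  CliffordAlgebra.contractLeft (Q := (0 : QuadraticForm K V)) f

lemma contr_ι_mul (f : Module.Dual K V) (a : V) (x : ExteriorAlgebra K V) :
    contr f (ExteriorAlgebra.ι K a * x) = f a • x - ExteriorAlgebra.ι K a * contr f x :=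
  CliffordAlgebra.contractLeft_ι_mul (Q := (0 : QuadraticForm K V)) f a x

lemma contr_one (f : Module.Dual K V) : contr f (1 : ExteriorAlgebra K V) = 0 :=
  CliffordAlgebra.contractLeft_one (Q := (0 : QuadraticForm K V)) f

lemma contr_eF_notMem (v : J → V) (f : Module.Dual K V) (s : Finset J)
    (h : ∀ j ∈ s, f (v j) = 0) : contr f (eF K v s) = 0 := by
  induction s using Finset.induction_on with
  | empty => simp [contr_one]
  | insert j s hj ih =>
    rw [eF_insert _ _ _ hj, contr_ι_mul, h j (by simp), ih (fun k hk => h k (by simp [hk]))]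
    simp

lemma contr_eF (v : J → V) (f : Module.Dual K V) (i : J) (s : Finset J)
    (h : ∀ j, f (v j) = if i = j then 1 else 0) :
    contr f (eF K v s) = if i ∈ s then eF K v (s.erase i) else 0 := by
  split_ifs with hi
  · conv_lhs => rw [← Finset.insert_erase hi]
    rw [eF_insert _ _ _ (Finset.notMem_erase _ _), contr_ι_mul, h i, contr_eF_notMem]
    · simp
    · intro j hj
      rw [h j, if_neg (Finset.ne_of_mem_erase hj).symm]
  · apply contr_eF_notMem
    intro j hj
    rw [h j, if_neg]
    rintro rfl
    exact hi hj

lemma exists_coef (v : J → V) (f : J → Module.Dual K V) (t : Finset J)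
    (h : ∀ i ∈ t, ∀ j, f i (v j) = if i = j then 1 else 0) :
    ∃ g : ExteriorAlgebra K V →ₗ[K] K, ∀ s, g (eF K v s) = if s = t then 1 else 0 := by
  induction t using Finset.induction_on with
  | empty =>
    refine ⟨(ExteriorAlgebra.algebraMapInv (R := K) (M := V)).toLinearMap, fun s => ?_⟩
    rcases s.eq_empty_or_nonempty with rfl | ⟨j, hj⟩
    · simp
    · rw [if_neg (Finset.ne_empty_of_mem hj), ← Finset.insert_erase hj,
        eF_insert _ _ _ (Finset.notMem_erase _ _)]
      simp [ExteriorAlgebra.algebraMapInv]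
  | insert i t hi ih =>
    obtain ⟨g, hg⟩ := ih (fun i hi => h i (by simp [hi]))
    refine ⟨g.comp (contr (f i)), fun s => ?_⟩
    rw [LinearMap.comp_apply, contr_eF v (f i) i s (h i (by simp))]
    by_cases his : i ∈ s
    · rw [if_pos his, hg]
      congr 1
      rw [Finset.erase_eq_iff_eq_insert his hi]
    · rw [if_neg his, map_zero, if_neg]
      rintro rfl
      simp at his

lemma eF_linearIndependent (bs : Module.Basis J K V) :
    LinearIndependent K (fun s => eF K bs s) := by
  have h : ∀ t, ∃ g : ExteriorAlgebra K V →ₗ[K] K,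
      ∀ s, g (eF K bs s) = if s = t then 1 else 0 := fun t =>
    exists_coef bs (fun i => bs.coord i) t (fun i _ j => by
      simp [Finsupp.single_apply, eq_comm])
  choose g hg using h
  rw [linearIndependent_iff']
  intro S c hc t ht
  have := congrArg (g t) hc
  simpa [hg, ht] using this

lemma eF_span (bs : Module.Basis J K V) :
    ⊤ ≤ Submodule.span K (Set.range (fun s => eF K bs s)) := by
  intro x _
  set M := Submodule.span K (Set.range (fun s => eF K bs s)) with hM
  have h1 : ∀ w : V, ∀ y ∈ M, ExteriorAlgebra.ι K w * y ∈ M := by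
    intro w y hy
    induction hy using Submodule.span_induction with
    | mem y hy =>
      obtain ⟨s, rfl⟩ := hy
      induction w using basis_ind bs with
      | zero => simp
      | add a b ha hb => rw [map_add, add_mul]; exact M.add_mem ha hb
      | smul c a ha => rw [map_smul, smul_mul_assoc]; exact M.smul_mem _ ha
      | basis j =>
        simp only
        rw [ι_mul_eF]
        split_ifs
        · exact M.zero_mem
        · exact Submodule.subset_span ⟨_, rfl⟩
    | zero => simp
    | add a b _ _ ha hb => rw [mul_add]; exact M.add_mem ha hb
    | smul c a _ ha => rw [mul_smul_comm]; exact M.smul_mem _ ha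
  have h2 : ∀ y ∈ M, x * y ∈ M := by
    induction x using ExteriorAlgebra.induction with
    | algebraMap r => intro y hy; rw [← Algebra.smul_def]; exact M.smul_mem _ hy
    | ι w => exact h1 w
    | mul a b ha hb => intro y hy; rw [mul_assoc]; exact ha trivial _ (hb trivial _ hy)
    | add a b ha hb =>
      intro y hy; rw [add_mul]; exact M.add_mem (ha trivial _ hy) (hb trivial _ hy)
  have := h2 1 (Submodule.subset_span ⟨∅, by simp⟩)
  simpa using this

/-- the monomial basis of the exterior algebra -/
def eB (bs : Module.Basis J K V) : Module.Basis (Finset J) K (ExteriorAlgebra K V) :=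
  Module.Basis.mk (eF_linearIndependent bs) (eF_span bs)

@[simp] lemma eB_apply (bs : Module.Basis J K V) (s : Finset J) : eB bs s = eF K bs s := by
  simp [eB]

lemma eB_repr_eF (bs : Module.Basis J K V) (s t : Finset J) :
    (eB bs).repr (eF K bs s) t = if s = t then 1 else 0 := by
  rw [← eB_apply, Module.Basis.repr_self, Finsupp.single_apply]

lemma eB_repr_ι_mul (bs : Module.Basis J K V) (w : V) (x : ExteriorAlgebra K V) (s : Finset J) :
    (eB bs).repr (ExteriorAlgebra.ι K w * x) s =
      ∑ i ∈ s, bs.repr w i * (eB bs).repr x (s.erase i) := by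
  induction x using basis_ind (eB bs) with
  | zero => simp
  | add a b ha hb => simp [mul_add, ha, hb, Finset.sum_add_distrib]
  | smul c a ha => simp [ha, Finset.mul_sum, mul_left_comm]
  | basis t =>
    induction w using basis_ind bs with
    | zero => simp
    | add a b ha hb => simp only [map_add, add_mul, ha, hb, Finset.sum_add_distrib,
        Finsupp.add_apply]
    | smul c a ha =>
      simp only [map_smul, smul_mul_assoc, Finsupp.smul_apply, ha, smul_eq_mul, Finset.mul_sum,
        mul_assoc]
    | basis j =>
      rw [eB_apply, ι_mul_eF]
      simp only [Module.Basis.repr_self, Finsupp.single_apply, eB_repr_eF, ite_mul, one_mul,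
        zero_mul, Finset.sum_ite_eq]
      by_cases hjt : j ∈ t
      · rw [if_pos hjt]
        split_ifs with h1 h2
        · rw [h2] at hjt; simp at hjt
        · simp
        · simp
      · rw [if_neg hjt, eB_repr_eF]
        by_cases hjs : j ∈ s
        · rw [if_pos hjs]
          congr 1
          rw [eq_comm (a := t), Finset.erase_eq_iff_eq_insert hjs hjt]
          exact propext eq_comm
        · rw [if_neg hjs, if_neg]
          rintro rfl
          simp at hjs

end ExtTwo

/-! ### Part 2: subfields and derivations in characteristic two -/

set_option linter.unusedSectionVars false

section DerTwo
variable {K : Type*} [Field K] [CharP K 2]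

lemma quad_closure (A : Subfield K) (c : K) (hc : c ^ 2 ∈ A) (z : K)
    (hz : z ∈ Subfield.closure ((A : Set K) ∪ {c})) : ∃ p ∈ A, ∃ q ∈ A, z = p + q * c := by
  have h2 : (2 : K) = 0 := CharTwo.two_eq_zero
  induction hz using Subfield.closure_induction with
  | mem x hx =>
    rcases hx with hx | hx
    · exact ⟨x, hx, 0, A.zero_mem, by ring⟩
    · rw [Set.mem_singleton_iff] at hx
      exact ⟨0, A.zero_mem, 1, A.one_mem, by rw [hx]; ring⟩
  | one => exact ⟨1, A.one_mem, 0, A.zero_mem, by ring⟩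
  | add x y _ _ hx hy =>
    obtain ⟨p, hp, q, hq, rfl⟩ := hx
    obtain ⟨p', hp', q', hq', rfl⟩ := hy
    exact ⟨p + p', A.add_mem hp hp', q + q', A.add_mem hq hq', by ring⟩
  | neg x _ hx =>
    obtain ⟨p, hp, q, hq, rfl⟩ := hx
    exact ⟨-p, A.neg_mem hp, -q, A.neg_mem hq, by ring⟩
  | inv x _ hx =>
    obtain ⟨p, hp, q, hq, rfl⟩ := hx
    have hN : p ^ 2 + q ^ 2 * c ^ 2 ∈ A :=
      A.add_mem (A.pow_mem hp 2) (A.mul_mem (A.pow_mem hq 2) hc)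
    have hN' : p ^ 2 + q ^ 2 * c ^ 2 = (p + q * c) ^ 2 := by
      linear_combination (- p * q * c) * h2
    refine ⟨p * (p ^ 2 + q ^ 2 * c ^ 2)⁻¹, A.mul_mem hp (A.inv_mem hN),
      q * (p ^ 2 + q ^ 2 * c ^ 2)⁻¹, A.mul_mem hq (A.inv_mem hN), ?_⟩
    rw [hN']
    by_cases h0 : p + q * c = 0
    · simp [h0]
    · field_simp
  | mul x y _ _ hx hy =>
    obtain ⟨p, hp, q, hq, rfl⟩ := hx
    obtain ⟨p', hp', q', hq', rfl⟩ := hy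
    exact ⟨p * p' + q * q' * c ^ 2,
      A.add_mem (A.mul_mem hp hp') (A.mul_mem (A.mul_mem hq hq') hc),
      p * q' + q * p', A.add_mem (A.mul_mem hp hq') (A.mul_mem hq hp'), by ring⟩

lemma exists_maximal_subfield (L₀ : Subfield K) (z : K) (hz : z ∉ L₀) :
    ∃ L : Subfield K, L₀ ≤ L ∧ z ∉ L ∧ ∀ L' : Subfield K, L ≤ L' → z ∉ L' → L' ≤ L := by
  obtain ⟨m, hm, hmax⟩ := zorn_le_nonempty₀ {L : Subfield K | z ∉ L} (fun c hc hchain y hy => by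
    refine ⟨sSup c, ?_, fun s hs => le_sSup hs⟩
    intro hzs
    rw [Subfield.mem_sSup_of_directedOn ⟨y, hy⟩ hchain.directedOn] at hzs
    obtain ⟨s, hs, hzs⟩ := hzs
    exact hc hs hzs) L₀ hz
  exact ⟨m, hm, hmax.prop, fun L' h1 h2 => hmax.le_of_ge h2 h1⟩

lemma exists_derivation (L₀ : Subfield K) (hsq : ∀ y : K, y ^ 2 ∈ L₀) (z : K) (hz : z ∉ L₀) :
    ∃ D : Derivation ℤ K K, (∀ y ∈ L₀, D y = 0) ∧ D z = 1 := by
  obtain ⟨L, hL, hzL, hmax⟩ := exists_maximal_subfield L₀ z hz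
  have hdec : ∀ y : K, ∃ p ∈ L, ∃ q ∈ L, y = p + q * z := by
    intro y
    by_cases hy : y ∈ L
    · exact ⟨y, hy, 0, L.zero_mem, by ring⟩
    · have hzc : z ∈ Subfield.closure ((L : Set K) ∪ {y}) := by
        by_contra hcon
        have := hmax _ (fun x hx => Subfield.subset_closure (Or.inl hx)) hcon
        exact hy (this (Subfield.subset_closure (Or.inr rfl)))
      obtain ⟨p, hp, q, hq, h⟩ := quad_closure L y (hL (hsq y)) z hzc
      have hq0 : q ≠ 0 := by
        rintro rfl
        apply hzL
        rw [h]
        simpa using hp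
      refine ⟨-(q⁻¹ * p), L.neg_mem (L.mul_mem (L.inv_mem hq) hp), q⁻¹, L.inv_mem hq, ?_⟩
      rw [h]
      field_simp
      ring
  have huniq : ∀ p ∈ L, ∀ q ∈ L, ∀ p' ∈ L, ∀ q' ∈ L, p + q * z = p' + q' * z → q = q' := by
    intro p hp q hq p' hp' q' hq' h
    by_contra hne
    apply hzL
    have h1 : q - q' ≠ 0 := sub_ne_zero.mpr hne
    have : z = (p' - p) * (q - q')⁻¹ := by
      field_simp
      linear_combination h
    rw [this]
    exact L.mul_mem (L.sub_mem hp' hp) (L.inv_mem (L.sub_mem hq hq'))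
  choose P hP Q hQ hPQ using hdec
  have key : ∀ y, ∀ p ∈ L, ∀ q ∈ L, y = p + q * z → Q y = q := fun y p hp q hq h =>
    huniq (P y) (hP y) (Q y) (hQ y) p hp q hq ((hPQ y).symm.trans h)
  have hadd : ∀ x y, Q (x + y) = Q x + Q y := fun x y =>
    key _ (P x + P y) (L.add_mem (hP x) (hP y)) _ (L.add_mem (hQ x) (hQ y)) (by
      linear_combination hPQ x + hPQ y)
  have hPval : ∀ x, P x = x - Q x * z := fun x => by linear_combination - hPQ x
  have h2 : (2 : K) = 0 := CharTwo.two_eq_zero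
  have hmul : ∀ x y, Q (x * y) = x * Q y + y * Q x := by
    intro x y
    have := key (x * y) (P x * P y + Q x * Q y * z ^ 2)
      (L.add_mem (L.mul_mem (hP x) (hP y)) (L.mul_mem (L.mul_mem (hQ x) (hQ y)) (hL (hsq z))))
      (P x * Q y + Q x * P y) (L.add_mem (L.mul_mem (hP x) (hQ y)) (L.mul_mem (hQ x) (hP y)))
      (by
        conv_lhs => rw [hPQ x, hPQ y]
        ring)
    rw [this, hPval, hPval]
    linear_combination (- Q x * Q y * z) * h2
  let Qa : K →+ K := AddMonoidHom.mk' Q hadd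
  refine ⟨Derivation.mk' Qa.toIntLinearMap (fun a b => ?_), ?_, ?_⟩
  · change Q (a * b) = a • Q b + b • Q a
    simpa using hmul a b
  · intro y hy
    exact key y y (hL hy) 0 L.zero_mem (by ring)
  · exact key z 0 L.zero_mem 1 L.one_mem (by ring)

lemma der_sq {M : Type*} [AddCommGroup M] [Module K M] (D : Derivation ℤ K M) (y : K) :
    D (y ^ 2) = 0 := by
  rw [pow_two, Derivation.leibniz, ← two_smul K, CharTwo.two_eq_zero, zero_smul]

/-- The subfield of constants of a derivation. -/
def derKer {M : Type*} [AddCommGroup M] [Module K M] (D : Derivation ℤ K M) : Subfield K where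
  carrier := {y | D y = 0}
  mul_mem' := by
    intro a b ha hb
    simp only [Set.mem_ofPred_eq] at *
    rw [Derivation.leibniz, ha, hb]; simp
  one_mem' := by simp
  add_mem' := by
    intro a b ha hb
    simp only [Set.mem_ofPred_eq] at *
    rw [map_add, ha, hb]; simp
  zero_mem' := by simp
  neg_mem' := by
    intro a ha
    simp only [Set.mem_ofPred_eq] at *
    rw [map_neg, ha]; simp
  inv_mem' := by
    intro a ha
    simp only [Set.mem_ofPred_eq] at *
    rw [Derivation.leibniz_inv, ha, smul_zero]

lemma mem_derKer {M : Type*} [AddCommGroup M] [Module K M] (D : Derivation ℤ K M) (y : K) :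
    y ∈ derKer D ↔ D y = 0 := Iff.rfl

/-- `K²(S)` -/
def sqAdj (S : Set K) : Subfield K := Subfield.closure (Set.range (fun y : K => y ^ 2) ∪ S)

lemma sq_mem_sqAdj (S : Set K) (y : K) : y ^ 2 ∈ sqAdj S :=
  Subfield.subset_closure (Or.inl ⟨y, rfl⟩)

lemma mem_sqAdj (S : Set K) (y : K) (h : y ∈ S) : y ∈ sqAdj S :=
  Subfield.subset_closure (Or.inr h)

lemma sqAdj_le_derKer {M : Type*} [AddCommGroup M] [Module K M] (D : Derivation ℤ K M) (S : Set K)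
    (h : ∀ y ∈ S, D y = 0) : sqAdj S ≤ derKer D := by
  rw [sqAdj, Subfield.closure_le]
  rintro y (⟨x, rfl⟩ | hy)
  · exact der_sq D x
  · exact h y hy

/-- Elements whose differential is a combination of the differentials of `S` lie in `K²(S)`. -/
lemma mem_sqAdj_of_D_mem_span (S : Set K) (z : K)
    (h : KaehlerDifferential.D ℤ K z ∈
      Submodule.span K ((KaehlerDifferential.D ℤ K) '' S)) : z ∈ sqAdj S := by
  by_contra hz
  obtain ⟨D, h0, h1⟩ := exists_derivation (sqAdj S) (sq_mem_sqAdj S) z hz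
  have hle : Submodule.span K ((KaehlerDifferential.D ℤ K) '' S) ≤
      LinearMap.ker D.liftKaehlerDifferential := by
    rw [Submodule.span_le]
    rintro _ ⟨y, hy, rfl⟩
    simp [h0 y (mem_sqAdj S y hy)]
  have := hle h
  rw [LinearMap.mem_ker, Derivation.liftKaehlerDifferential_comp_D, h1] at this
  exact one_ne_zero this

/-- a dual functional for an element outside `K²(S)` -/
lemma exists_dual (S : Set K) (z : K) (hz : z ∉ sqAdj S) :
    ∃ f : Module.Dual K (KaehlerDifferential ℤ K),
      (∀ y ∈ S, f (KaehlerDifferential.D ℤ K y) = 0) ∧ f (KaehlerDifferential.D ℤ K z) = 1 := by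
  obtain ⟨D, h0, h1⟩ := exists_derivation (sqAdj S) (sq_mem_sqAdj S) z hz
  exact ⟨D.liftKaehlerDifferential, fun y hy => by simp [h0 y (mem_sqAdj S y hy)], by simp [h1]⟩

end DerTwo

set_option linter.unusedSectionVars false

/-! ### Part 3: two-independence and adapted bases -/

section Indep
variable {F : Type*} [Field F] [CharP F 2]

lemma sqAdj_repr {r : ℕ} (b : Fin r → F) (s : Finset (Fin r)) (z : F)
    (hz : z ∈ sqAdj (b '' (s : Set (Fin r)))) :
    ∃ c : Finset (Fin r) → F, z = ∑ t ∈ s.powerset, c t ^ 2 * ∏ i ∈ t, b i := by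
  induction s using Finset.induction_on generalizing z with
  | empty =>
    simp only [Finset.coe_empty, Set.image_empty] at hz
    have : ∃ c : F, z = c ^ 2 := by
      unfold sqAdj at hz
      induction hz using Subfield.closure_induction with
      | mem x hx =>
        rcases hx with ⟨y, rfl⟩ | hx
        · exact ⟨y, rfl⟩
        · exact absurd hx (Set.notMem_empty _)
      | one => exact ⟨1, by simp⟩
      | add x y _ _ hx hy =>
        obtain ⟨c, rfl⟩ := hx
        obtain ⟨d, rfl⟩ := hy
        exact ⟨c + d, (CharTwo.add_sq c d).symm⟩
      | neg x _ hx => exact (by rw [CharTwo.neg_eq]; exact hx)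
      | inv x _ hx =>
        obtain ⟨c, rfl⟩ := hx
        exact ⟨c⁻¹, by simp⟩
      | mul x y _ _ hx hy =>
        obtain ⟨c, rfl⟩ := hx
        obtain ⟨d, rfl⟩ := hy
        exact ⟨c * d, by ring⟩
    obtain ⟨c, rfl⟩ := this
    exact ⟨fun _ => c, by simp⟩
  | insert j s hj ih =>
    have hle : sqAdj (b '' ((insert j s : Finset (Fin r)) : Set (Fin r))) ≤
        Subfield.closure ((sqAdj (b '' (s : Set (Fin r))) : Set F) ∪ {b j}) := by
      conv_lhs => unfold sqAdj
      rw [Subfield.closure_le]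
      rintro y (⟨x, rfl⟩ | ⟨i, hi, rfl⟩)
      · exact Subfield.subset_closure (Or.inl (sq_mem_sqAdj _ x))
      · rcases Finset.mem_insert.mp (Finset.mem_coe.mp hi) with rfl | hi
        · exact Subfield.subset_closure (Or.inr rfl)
        · exact Subfield.subset_closure (Or.inl (mem_sqAdj _ _ ⟨i, hi, rfl⟩))
    obtain ⟨p, hp, q, hq, rfl⟩ := quad_closure _ _ (sq_mem_sqAdj _ _) z (hle hz)
    obtain ⟨c, hc⟩ := ih p hp
    obtain ⟨d, hd⟩ := ih q hq
    refine ⟨fun t => if j ∈ t then d (t.erase j) else c t, ?_⟩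
    rw [Finset.sum_powerset_insert hj, hc, hd, Finset.sum_mul]
    congr 1
    · refine Finset.sum_congr rfl fun t ht => ?_
      have : j ∉ t := fun h => hj (Finset.mem_powerset.mp ht h)
      simp [this]
    · refine Finset.sum_congr rfl fun t ht => ?_
      have : j ∉ t := fun h => hj (Finset.mem_powerset.mp ht h)
      simp only [Finset.mem_insert_self, if_true, Finset.erase_insert this,
        Finset.prod_insert this]
      ring

lemma TwoIndep.finset {r : ℕ} {b : Fin r → F} (hb : TwoIndep b) (c : Finset (Fin r) → F)
    (hc : ∑ t, c t ^ 2 * ∏ i ∈ t, b i = 0) (t : Finset (Fin r)) : c t = 0 := by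
  let φ : (Fin r → Fin 2) ≃ Finset (Fin r) :=
    { toFun := fun e => Finset.univ.filter (fun i => e i = 1)
      invFun := fun t i => if i ∈ t then 1 else 0
      left_inv := by
        intro e
        funext i
        simp only [Finset.mem_filter, Finset.mem_univ, true_and]
        have : e i = 0 ∨ e i = 1 := by
          generalize e i = k
          fin_cases k <;> simp
        rcases this with h | h <;> simp [h]
      right_inv := by
        intro t
        ext i
        simp }
  have := hb (fun e => c (φ e)) (by
    rw [← hc]
    refine Fintype.sum_equiv φ _ _ fun e => ?_
    congr 1
    change _ = ∏ i ∈ Finset.univ.filter (fun i => e i = 1), b i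
    rw [Finset.prod_filter]
    refine Finset.prod_congr rfl fun i _ => ?_
    generalize e i = k
    fin_cases k <;> simp) (φ.symm t)
  simpa using this

lemma TwoIndep.notMem {r : ℕ} {b : Fin r → F} (hb : TwoIndep b) (i : Fin r) :
    b i ∉ sqAdj (b '' ((Finset.univ.erase i : Finset (Fin r)) : Set (Fin r))) := by
  intro h
  obtain ⟨c, hc⟩ := sqAdj_repr b _ _ h
  have := hb.finset (fun t => if i ∈ t then (if t = {i} then 1 else 0) else c t) (by
    have h1 : (Finset.univ : Finset (Finset (Fin r))) =
        (insert i (Finset.univ.erase i)).powerset := by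
      rw [Finset.insert_erase (Finset.mem_univ i)]; simp
    rw [h1, Finset.sum_powerset_insert (Finset.notMem_erase _ _)]
    have h2 : ∑ t ∈ (Finset.univ.erase i).powerset,
        (if i ∈ t then (if t = {i} then (1 : F) else 0) else c t) ^ 2 * ∏ i ∈ t, b i = b i := by
      rw [hc]
      refine Finset.sum_congr rfl fun t ht => ?_
      have : i ∉ t := fun h => by simpa using Finset.mem_powerset.mp ht h
      simp [this]
    rw [h2, Finset.sum_eq_single ∅]
    · simpa using CharTwo.add_self_eq_zero (b i)
    · intro t ht ht0
      have hit : i ∉ t := fun h => by simpa using Finset.mem_powerset.mp ht h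
      have : insert i t ≠ {i} := by
        intro h
        apply ht0
        rw [← Finset.erase_insert hit, h]
        simp
      simp [this]
    · simp) {i}
  simp at this

lemma TwoIndep.linearIndependent {r : ℕ} {b : Fin r → F} (hb : TwoIndep b) :
    LinearIndependent F (fun i => KaehlerDifferential.D ℤ F (b i)) := by
  rw [linearIndependent_iff']
  intro S c hc i hi
  obtain ⟨f, h0, h1⟩ := exists_dual _ _ (hb.notMem i)
  have := congrArg f hc
  rw [map_sum, Finset.sum_eq_single i] at this
  · simpa [h1] using this
  · intro j _ hj
    rw [map_smul, h0 (b j) ⟨j, by simp [hj], rfl⟩, smul_zero]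
  · exact fun h => absurd hi h

/-- A basis of logarithmic differentials adapted to `b`, indexed by a well-order in which the
indices of the `b i` form an initial segment. -/
lemma exists_adapted_basis.{u} {F : Type u} [Field F] [CharP F 2] {r : ℕ} {b : Fin r → F}
    (hb : TwoIndep b) :
    ∃ (J : Type u) (_ : LinearOrder J) (_ : WellFoundedLT J) (x : J → F)
      (bs : Module.Basis J F (KaehlerDifferential ℤ F)) (k : Fin r → J),
      (∀ j, x j ≠ 0) ∧ (∀ j, bs j = (x j)⁻¹ • KaehlerDifferential.D ℤ F (x j)) ∧
      (∀ i, x (k i) = b i) ∧ Function.Injective k ∧ (∀ j i, j ≤ k i → j ∈ Set.range k) := by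
  have hli := hb.linearIndependent
  set D := KaehlerDifferential.D ℤ F with hD
  have hli' := hli.linearIndepOn_id
  obtain ⟨B, hBt, hsB, hspan, hB⟩ := exists_linearIndepOn_id_extension (t := Set.range D) hli' (by
    rintro _ ⟨i, rfl⟩; exact ⟨_, rfl⟩)
  set s := Set.range (fun i => D (b i)) with hs
  let J' := ↥(B \ s)
  obtain ⟨lo, wf⟩ := exists_wellFoundedLT J'
  have hpre : ∀ j : J', ∃ y, D y = j := fun j => hBt j.2.1
  choose y hy using hpre
  let x₀ : Fin r ⊕ J' → F := Sum.elim b y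
  let v : Fin r ⊕ J' → KaehlerDifferential ℤ F := fun j => D (x₀ j)
  have hvB : ∀ j, v j ∈ B := by
    rintro (i | j)
    · exact hsB ⟨i, rfl⟩
    · change D (y j) ∈ B
      rw [hy]; exact j.2.1
  have hvinj : Function.Injective v := by
    rintro (i | j) (i' | j') h
    · exact congrArg Sum.inl (hli.injective h)
    · exfalso
      apply j'.2.2
      rw [← hy j']
      exact ⟨i, h⟩
    · exfalso
      apply j.2.2
      rw [← hy j]
      exact ⟨i', h.symm⟩
    · change D (y j) = D (y j') at h
      rw [hy, hy] at h
      exact congrArg Sum.inr (Subtype.ext h)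
  have hvli : LinearIndependent F v := by
    have := hB.linearIndependent
    exact this.comp (fun j => ⟨v j, hvB j⟩) (fun a c h => hvinj (congrArg Subtype.val h))
  have hx0 : ∀ j, x₀ j ≠ 0 := by
    intro j h
    apply hvli.ne_zero j
    change D (x₀ j) = 0
    rw [h, map_zero]
  have hli2 : LinearIndependent F (fun j => (x₀ j)⁻¹ • v j) := by
    exact hvli.units_smul (fun j => Units.mk0 (x₀ j)⁻¹ (inv_ne_zero (hx0 j)))
  have hsp2 : ⊤ ≤ Submodule.span F (Set.range (fun j => (x₀ j)⁻¹ • v j)) := by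
    rw [← KaehlerDifferential.span_range_derivation ℤ F, Submodule.span_le]
    refine hspan.trans ?_
    rw [SetLike.coe_subset_coe, Submodule.span_le]
    intro w hw
    have hmem : ∀ j, v j ∈ Submodule.span F (Set.range (fun j => (x₀ j)⁻¹ • v j)) := by
      intro j
      have h1 : v j = x₀ j • ((x₀ j)⁻¹ • v j) := by rw [smul_smul, mul_inv_cancel₀ (hx0 j), one_smul]
      rw [h1]
      exact Submodule.smul_mem _ _ (Submodule.subset_span ⟨j, rfl⟩)
    by_cases hws : w ∈ s
    · obtain ⟨i, rfl⟩ := hws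
      exact hmem (Sum.inl i)
    · have := hmem (Sum.inr ⟨w, hw, hws⟩)
      change D (y _) ∈ _ at this
      rwa [hy] at this
  let bs := Module.Basis.mk hli2 hsp2
  refine ⟨Fin r ⊕ₗ J', inferInstance, ⟨?_⟩, fun j => x₀ (ofLex j), bs.reindex toLex,
    fun i => toLex (Sum.inl i), fun j => hx0 _, fun j => ?_, fun i => rfl,
    fun i i' h => Sum.inl_injective (toLex.injective h), ?_⟩
  · exact Sum.lex_wf wellFounded_lt wellFounded_lt
  · simp [bs, v]
  · intro j i hji
    rcases j with i' | j'
    · exact ⟨i', rfl⟩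
    · exact absurd hji (Sum.Lex.not_inr_le_inl)

end Indep

set_option linter.unusedSectionVars false

/-! ### Part 4: logarithmic derivations, independence over `E` -/

section LogDer
variable {F : Type*} [Field F] [CharP F 2] {J : Type*} [DecidableEq J]

/-- The logarithmic partial derivative `x_i ∂/∂x_i`. -/
def th (bs : Module.Basis J F (KaehlerDifferential ℤ F)) (i : J) : Derivation ℤ F F :=
  (bs.coord i).compDer (KaehlerDifferential.D ℤ F)

variable (x : J → F) (bs : Module.Basis J F (KaehlerDifferential ℤ F))

lemma th_apply (i : J) (y : F) : th bs i y = bs.repr (KaehlerDifferential.D ℤ F y) i := rfl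

lemma th_x (hx : ∀ j, x j ≠ 0)
    (hbs : ∀ j, bs j = (x j)⁻¹ • KaehlerDifferential.D ℤ F (x j)) (i j : J) :
    th bs i (x j) = if i = j then x j else 0 := by
  have h : KaehlerDifferential.D ℤ F (x j) = x j • bs j := by
    rw [hbs, smul_smul, mul_inv_cancel₀ (hx j), one_smul]
  rw [th_apply, h, map_smul, Module.Basis.repr_self, Finsupp.smul_apply, Finsupp.single_apply]
  simp [eq_comm]

lemma sq_descent {r : ℕ} (b : Fin r → F) (k : Fin r → J) (hx : ∀ j, x j ≠ 0)
    (hbs : ∀ j, bs j = (x j)⁻¹ • KaehlerDifferential.D ℤ F (x j))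
    (hk : ∀ i, x (k i) = b i) (hkinj : Function.Injective k)
    (G : Subfield F) (hG : ∀ l, b l ∈ G) (w : F) (s : Finset (Fin r))
    (hz : w ^ 2 ∈ Subfield.closure ((G.map (frobenius F 2) : Set F) ∪ b '' (s : Set (Fin r)))) :
    w ∈ G := by
  induction s using Finset.induction_on with
  | empty =>
    simp only [Finset.coe_empty, Set.image_empty, Set.union_empty, Subfield.closure_eq] at hz
    obtain ⟨g, hg, hgw⟩ := hz
    rw [frobenius_def] at hgw
    have : g = w := frobenius_inj F 2 (by simpa [frobenius_def] using hgw)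
    rwa [← this]
  | insert j s hj ih =>
    set A := Subfield.closure ((G.map (frobenius F 2) : Set F) ∪ b '' (s : Set (Fin r))) with hA
    have hle : Subfield.closure ((G.map (frobenius F 2) : Set F) ∪
        b '' ((insert j s : Finset (Fin r)) : Set (Fin r))) ≤
        Subfield.closure ((A : Set F) ∪ {b j}) := by
      rw [Subfield.closure_le]
      rintro y (hy | ⟨i, hi, rfl⟩)
      · exact Subfield.subset_closure (Or.inl (Subfield.subset_closure (Or.inl hy)))
      · rcases Finset.mem_insert.mp (Finset.mem_coe.mp hi) with rfl | hi
        · exact Subfield.subset_closure (Or.inr rfl)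
        · exact Subfield.subset_closure (Or.inl (Subfield.subset_closure (Or.inr ⟨i, hi, rfl⟩)))
    have hbj : b j ^ 2 ∈ A := Subfield.subset_closure (Or.inl ⟨b j, hG j, by simp [frobenius_def]⟩)
    obtain ⟨p, hp, q, hq, h⟩ := quad_closure A (b j) hbj _ (hle hz)
    have hker : A ≤ derKer (th bs (k j)) := by
      rw [hA, Subfield.closure_le]
      rintro y (⟨g, _, rfl⟩ | ⟨i, hi, rfl⟩)
      · exact der_sq _ g
      · change th bs (k j) (b i) = 0
        rw [← hk i, th_x x bs hx hbs, if_neg]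
        intro hh
        exact hj (hkinj hh ▸ hi)
    have h1 : th bs (k j) (w ^ 2) = 0 := der_sq _ w
    have hp0 : th bs (k j) p = 0 := hker hp
    have hq0 : th bs (k j) q = 0 := hker hq
    rw [h, map_add, Derivation.leibniz, hp0, hq0, ← hk j, th_x x bs hx hbs, if_pos rfl] at h1
    have hqz : q = 0 := by
      have := hx (k j)
      simpa [this] using h1
    apply ih
    rw [h, hqz]
    simpa using hp

lemma pow_notMem {r : ℕ} (b : Fin r → F) (k : Fin r → J) (hx : ∀ j, x j ≠ 0)
    (hbs : ∀ j, bs j = (x j)⁻¹ • KaehlerDifferential.D ℤ F (x j))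
    (hk : ∀ i, x (k i) = b i) (hkinj : Function.Injective k) (i : J) (hi : i ∉ Set.range k)
    (t : ℕ) :
    x i ^ 2 ^ t ∉ Subfield.closure (Set.range (fun y : F => y ^ 2 ^ (t + 1)) ∪ Set.range b ∪
      (fun y : F => y ^ 2 ^ t) '' (x '' {j | j ≠ i})) := by
  induction t with
  | zero =>
    intro h
    have hle : Subfield.closure (Set.range (fun y : F => y ^ 2 ^ (0 + 1)) ∪ Set.range b ∪
      (fun y : F => y ^ 2 ^ 0) '' (x '' {j | j ≠ i})) ≤ derKer (th bs i) := by
      rw [Subfield.closure_le]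
      rintro _ ((⟨g, rfl⟩ | ⟨l, rfl⟩) | ⟨_, ⟨j, hj, rfl⟩, rfl⟩)
      · simpa [mem_derKer] using der_sq (th bs i) g
      · change th bs i (b l) = 0
        rw [← hk l, th_x x bs hx hbs, if_neg]
        rintro rfl
        exact hi ⟨l, rfl⟩
      · simp only [pow_zero, pow_one]
        change th bs i (x j) = 0
        rw [th_x x bs hx hbs, if_neg]
        exact fun h => hj h.symm
    have := hle h
    simp only [pow_zero, pow_one] at this
    rw [mem_derKer, th_x x bs hx hbs, if_pos rfl] at this
    exact hx i this
  | succ t ih =>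
    intro h
    apply ih
    refine sq_descent x bs b k hx hbs hk hkinj _
      (fun l => Subfield.subset_closure (Or.inl (Or.inr ⟨l, rfl⟩))) _ Finset.univ ?_
    rw [← pow_mul, ← pow_succ]
    refine (Subfield.closure_le.mpr ?_ : _ ≤ _) h
    rintro _ ((⟨g, rfl⟩ | ⟨l, rfl⟩) | ⟨_, ⟨j, hj, rfl⟩, rfl⟩)
    · refine Subfield.subset_closure (Or.inl ⟨g ^ 2 ^ (t + 1),
        Subfield.subset_closure (Or.inl (Or.inl ⟨g, rfl⟩)), ?_⟩)
      rw [frobenius_def, ← pow_mul, ← pow_succ]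
    · exact Subfield.subset_closure (Or.inr ⟨l, by simp, rfl⟩)
    · refine Subfield.subset_closure (Or.inl ⟨x j ^ 2 ^ t,
        Subfield.subset_closure (Or.inr ⟨_, ⟨j, hj, rfl⟩, rfl⟩), ?_⟩)
      rw [frobenius_def, ← pow_mul, ← pow_succ]

variable {E : Type*} [Field E] [Algebra F E] [CharP E 2]

lemma notMem_E {r : ℕ} (b : Fin r → F) (k : Fin r → J) (hx : ∀ j, x j ≠ 0)
    (hbs : ∀ j, bs j = (x j)⁻¹ • KaehlerDifferential.D ℤ F (x j))
    (hk : ∀ i, x (k i) = b i) (hkinj : Function.Injective k) (i : J) (hi : i ∉ Set.range k)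
    (m : Fin r → ℕ) (β : Fin r → E) (hβ : ∀ i, β i ^ 2 ^ m i = algebraMap F E (b i))
    (hgen : Algebra.adjoin F (Set.range β) = ⊤) :
    algebraMap F E (x i) ∉ sqAdj ((fun j => algebraMap F E (x j)) '' {j | j ≠ i}) := by
  intro h
  set M := ∑ i, m i with hM
  have hmM : ∀ i, m i ≤ M := fun i => Finset.single_le_sum (fun _ _ => Nat.zero_le _)
    (Finset.mem_univ i)
  apply pow_notMem x bs b k hx hbs hk hkinj i hi M
  set S := Subfield.closure (Set.range (fun y : F => y ^ 2 ^ (M + 1)) ∪ Set.range b ∪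
      (fun y : F => y ^ 2 ^ M) '' (x '' {j | j ≠ i})) with hS
  have h1 : ∀ e : E, e ^ 2 ^ (M + 1) ∈ S.map (algebraMap F E) := by
    intro e
    have he : e ∈ Algebra.adjoin F (Set.range β) := by rw [hgen]; trivial
    induction he using Algebra.adjoin_induction with
    | mem y hy =>
      obtain ⟨l, rfl⟩ := hy
      have h2 : β l ^ 2 ^ (M + 1) = algebraMap F E (b l ^ 2 ^ (M + 1 - m l)) := by
        rw [map_pow, ← hβ, ← pow_mul, ← pow_add]
        congr 2
        have := hmM l
        omega
      rw [h2]
      exact ⟨_, S.pow_mem (Subfield.subset_closure (Or.inl (Or.inr ⟨l, rfl⟩))) _, rfl⟩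
    | algebraMap y =>
      rw [← map_pow]
      exact ⟨_, Subfield.subset_closure (Or.inl (Or.inl ⟨y, rfl⟩)), rfl⟩
    | add a c _ _ ha hc =>
      rw [add_pow_char_pow]
      exact Subfield.add_mem _ ha hc
    | mul a c _ _ ha hc =>
      rw [mul_pow]
      exact Subfield.mul_mem _ ha hc
  have h2 : sqAdj ((fun j => algebraMap F E (x j)) '' {j | j ≠ i}) ≤
      (S.map (algebraMap F E)).comap (iterateFrobenius E 2 M) := by
    rw [sqAdj, Subfield.closure_le]
    rintro _ (⟨e, rfl⟩ | ⟨j, hj, rfl⟩)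
    · change iterateFrobenius E 2 M (e ^ 2) ∈ S.map (algebraMap F E)
      rw [iterateFrobenius_def, ← pow_mul, ← pow_succ']
      exact h1 e
    · change iterateFrobenius E 2 M (algebraMap F E (x j)) ∈ S.map (algebraMap F E)
      rw [iterateFrobenius_def, ← map_pow]
      exact ⟨_, Subfield.subset_closure (Or.inr ⟨_, ⟨j, hj, rfl⟩, rfl⟩), rfl⟩
  have h3 : iterateFrobenius E 2 M (algebraMap F E (x i)) ∈ S.map (algebraMap F E) := h2 h
  rw [iterateFrobenius_def, ← map_pow] at h3
  obtain ⟨y, hy, hyx⟩ := h3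
  rwa [← (algebraMap F E).injective hyx]

lemma exists_dual_E {r : ℕ} (b : Fin r → F) (k : Fin r → J) (hx : ∀ j, x j ≠ 0)
    (hbs : ∀ j, bs j = (x j)⁻¹ • KaehlerDifferential.D ℤ F (x j))
    (hk : ∀ i, x (k i) = b i) (hkinj : Function.Injective k) (i : J) (hi : i ∉ Set.range k)
    (m : Fin r → ℕ) (β : Fin r → E) (hβ : ∀ i, β i ^ 2 ^ m i = algebraMap F E (b i))
    (hgen : Algebra.adjoin F (Set.range β) = ⊤) :
    ∃ f : Module.Dual E (KaehlerDifferential ℤ E), ∀ j,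
      f ((algebraMap F E (x j))⁻¹ • KaehlerDifferential.D ℤ E (algebraMap F E (x j))) =
        if i = j then 1 else 0 := by
  have hxi : algebraMap F E (x i) ≠ 0 := by simpa using hx i
  obtain ⟨f, h0, h1⟩ := exists_dual _ _ (notMem_E x bs b k hx hbs hk hkinj i hi m β hβ hgen)
  refine ⟨algebraMap F E (x i) • f, fun j => ?_⟩
  rw [LinearMap.smul_apply, map_smul]
  split_ifs with h
  · rw [← h, h1]; simp [hxi]
  · rw [h0 _ ⟨j, fun hh => h hh.symm, rfl⟩]; simp

lemma D_E_zero {r : ℕ} (b : Fin r → F) (m : Fin r → ℕ) (hm : ∀ i, 1 ≤ m i)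
    (β : Fin r → E) (hβ : ∀ i, β i ^ 2 ^ m i = algebraMap F E (b i))
    (u : F) (hu : u ∈ sqSubfield b) : KaehlerDifferential.D ℤ E (algebraMap F E u) = 0 := by
  have hle : sqSubfield b ≤ (derKer (KaehlerDifferential.D ℤ E)).comap (algebraMap F E) := by
    rw [sqSubfield, Subfield.closure_le]
    rintro _ (⟨y, rfl⟩ | ⟨i, rfl⟩)
    · change KaehlerDifferential.D ℤ E (algebraMap F E (y ^ 2)) = 0
      rw [map_pow, der_sq]
    · change KaehlerDifferential.D ℤ E (algebraMap F E (b i)) = 0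
      obtain ⟨n, hn⟩ := Nat.exists_eq_add_of_le' (hm i)
      rw [← hβ, hn, pow_succ, pow_mul, der_sq]
  exact hle hu

end LogDer

set_option linter.unusedSectionVars false

/-! ### Part 5: the colexicographic order and Kato's construction -/

section Col
variable {J : Type*} [LinearOrder J]

lemma colex_lt_of_forall_lt {s t : Finset J} {j : J} (hs : ∀ i ∈ s, i < j) (hj : j ∈ t) :
    toColex s < toColex t := by
  refine lt_of_lt_of_le (b := toColex {j}) ?_ ?_
  · rw [Finset.Colex.toColex_lt_singleton]; exact hs
  · exact Finset.Colex.toColex_le_toColex_of_subset (by simpa using hj)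

lemma colex_insert_lt {s t : Finset J} {j : J} (hs : j ∉ s) (ht : j ∉ t)
    (h : toColex s < toColex t) : toColex (insert j s) < toColex (insert j t) := by
  have := Finset.Colex.toColex_sdiff_lt_toColex_sdiff (s := insert j s) (t := insert j t)
    (u := {j}) (by simp) (by simp)
  rw [← this]
  have h1 : insert j s \ {j} = s := by
    rw [Finset.sdiff_singleton_eq_erase, Finset.erase_insert hs]
  have h2 : insert j t \ {j} = t := by
    rw [Finset.sdiff_singleton_eq_erase, Finset.erase_insert ht]
  rwa [h1, h2]

lemma colex_swap_lt {s : Finset J} {i k : J} (hk : k ∉ s) (hi : i ∈ s) (h : i < k) :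
    toColex s < toColex ((insert k s).erase i) := by
  have h1 : (insert k s).erase i = insert k (s.erase i) := by
    rw [Finset.erase_insert_of_ne h.ne']
  rw [h1]
  conv_lhs => rw [← Finset.insert_erase hi]
  exact (Finset.Colex.insert_lt_insert (Finset.notMem_erase _ _) (by simp [hk])).mpr h

lemma colex_acc_insert {a : J}
    (IH : ∀ s : Finset J, (∀ i ∈ s, i < a) → Acc (· < ·) (toColex s))
    (t : Finset J) (ht : ∀ i ∈ t, i < a) : Acc (· < ·) (toColex (insert a t)) := by
  have hacc := IH t ht
  generalize hT : toColex t = T at hacc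
  induction hacc generalizing t with
  | intro T _ ih =>
    subst hT
    have hat : a ∉ t := fun h => lt_irrefl _ (ht a h)
    refine Acc.intro _ fun S hS => ?_
    obtain ⟨s, hsS⟩ : ∃ s : Finset J, toColex s = S := ⟨ofColex S, rfl⟩
    rw [← hsS] at hS ⊢
    have hle : ∀ i ∈ s, i ≤ a := Finset.Colex.forall_le_mono hS.le (by
      intro i hi
      rcases Finset.mem_insert.mp hi with rfl | hi
      · exact le_rfl
      · exact (ht i hi).le)
    by_cases has : a ∈ s
    · have h1 : toColex (s.erase a) < toColex t := by
        have := Finset.Colex.toColex_sdiff_lt_toColex_sdiff (s := s) (t := insert a t)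
          (u := {a}) (by simpa using has) (by simp)
        have h2 := this.mpr hS
        rw [Finset.sdiff_singleton_eq_erase, Finset.sdiff_singleton_eq_erase,
          Finset.erase_insert hat] at h2
        exact h2
      have := ih _ h1 (s.erase a) (fun i hi => lt_of_le_of_ne (hle i (Finset.mem_of_mem_erase hi))
        (Finset.ne_of_mem_erase hi)) rfl
      rwa [Finset.insert_erase has] at this
    · exact IH s fun i hi => lt_of_le_of_ne (hle i hi) (fun h => has (h ▸ hi))

lemma colex_wf [WellFoundedLT J] (s : Finset J) : Acc (· < ·) (toColex s) := by
  have step : ∀ a : J, ∀ s : Finset J, (∀ i ∈ s, i < a) → Acc (· < ·) (toColex s) := by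
    intro a
    induction a using WellFoundedLT.induction with
    | ind a ih =>
      intro s hs
      rcases s.eq_empty_or_nonempty with rfl | hne
      · refine Acc.intro _ fun S hS => ?_
        exact absurd hS (by rw [Finset.Colex.toColex_empty]; exact not_lt_bot)
      · have hmem := s.max'_mem hne
        have := colex_acc_insert (ih _ (hs _ hmem)) (s.erase (s.max' hne))
          (fun i hi => s.lt_max'_of_mem_erase_max' hne hi)
        rwa [Finset.insert_erase hmem] at this
  rcases s.eq_empty_or_nonempty with rfl | hne
  · refine Acc.intro _ fun S hS => ?_
    exact absurd hS (by rw [Finset.Colex.toColex_empty]; exact not_lt_bot)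
  · have hmem := s.max'_mem hne
    have := colex_acc_insert (step (s.max' hne)) (s.erase (s.max' hne))
      (fun i hi => s.lt_max'_of_mem_erase_max' hne hi)
    rwa [Finset.insert_erase hmem] at this

end Col

section Kato
variable {F : Type*} [Field F] [CharP F 2] {J : Type*} [LinearOrder J]
variable (x : J → F) (bs : Module.Basis J F (KaehlerDifferential ℤ F))

lemma der_ext_x (hx : ∀ j, x j ≠ 0)
    (hbs : ∀ j, bs j = (x j)⁻¹ • KaehlerDifferential.D ℤ F (x j))
    (D₁ D₂ : Derivation ℤ F F) (h : ∀ j, D₁ (x j) = D₂ (x j)) (y : F) : D₁ y = D₂ y := by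
  have : D₁.liftKaehlerDifferential = D₂.liftKaehlerDifferential := by
    apply bs.ext
    intro j
    rw [hbs, map_smul, map_smul, Derivation.liftKaehlerDifferential_comp_D,
      Derivation.liftKaehlerDifferential_comp_D, h]
  rw [← Derivation.liftKaehlerDifferential_comp_D D₁, this,
    Derivation.liftKaehlerDifferential_comp_D]

lemma th_comm (hx : ∀ j, x j ≠ 0)
    (hbs : ∀ j, bs j = (x j)⁻¹ • KaehlerDifferential.D ℤ F (x j)) (i j : J) (y : F) :
    th bs i (th bs j y) = th bs j (th bs i y) := by
  have := der_ext_x x bs hx hbs ⁅th bs i, th bs j⁆ 0 (fun l => by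
    rw [Derivation.commutator_apply]
    simp only [th_x x bs hx hbs]
    by_cases h1 : i = l <;> by_cases h2 : j = l <;> simp [h1, h2, th_x x bs hx hbs]) y
  rw [Derivation.commutator_apply] at this
  simpa [sub_eq_zero] using this

lemma th_idem (hx : ∀ j, x j ≠ 0)
    (hbs : ∀ j, bs j = (x j)⁻¹ • KaehlerDifferential.D ℤ F (x j)) (i : J) (y : F) :
    th bs i (th bs i y) = th bs i y := by
  have h2 : (2 : F) = 0 := CharTwo.two_eq_zero
  let D : Derivation ℤ F F := Derivation.mk'
    ((th bs i : F →ₗ[ℤ] F).comp (th bs i : F →ₗ[ℤ] F)) (fun a c => by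
      change th bs i (th bs i (a * c)) = a • th bs i (th bs i c) + c • th bs i (th bs i a)
      simp only [Derivation.leibniz, map_add, smul_eq_mul]
      linear_combination (th bs i a * th bs i c) * h2)
  exact der_ext_x x bs hx hbs D (th bs i) (fun l => by
    change th bs i (th bs i (x l)) = _
    simp only [th_x x bs hx hbs]
    by_cases h1 : i = l <;> simp [h1, th_x x bs hx hbs]) y

/-- `z` is a sum of elements of the images of the `th i`, `i ∈ s`. -/
def inK (s : Finset J) (z : F) : Prop := ∃ g : J → F, z = ∑ i ∈ s, th bs i (g i)

lemma th_sq_mul (i : J) (c z : F) : th bs i (c ^ 2 * z) = c ^ 2 * th bs i z := by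
  rw [Derivation.leibniz, der_sq]; simp

lemma inK_sq_mul (s : Finset J) (z c : F) (h : inK bs s z) : inK bs s (c ^ 2 * z) := by
  obtain ⟨g, rfl⟩ := h
  exact ⟨fun i => c ^ 2 * g i, by
    simp only [th_sq_mul, Finset.mul_sum]⟩

lemma inK_empty (z : F) (h : inK bs ∅ z) : z = 0 := by
  obtain ⟨g, rfl⟩ := h
  simp

lemma inK_zero (s : Finset J) : inK bs s 0 := ⟨fun _ => 0, by simp⟩

lemma inK_proj (hx : ∀ j, x j ≠ 0)
    (hbs : ∀ j, bs j = (x j)⁻¹ • KaehlerDifferential.D ℤ F (x j)) (s : Finset J) (j : J) (z : F)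
    (h : inK bs s z) : inK bs (s.erase j) (z - th bs j z) := by
  obtain ⟨g, rfl⟩ := h
  refine ⟨fun i => g i - th bs j (g i), ?_⟩
  rw [map_sum, ← Finset.sum_sub_distrib]
  symm
  have : ∀ i, th bs i (g i - th bs j (g i)) = th bs i (g i) - th bs j (th bs i (g i)) := by
    intro i
    rw [map_sub, th_comm x bs hx hbs i j]
  simp only [this]
  apply Finset.sum_subset (Finset.erase_subset _ _)
  intro i hi hi'
  have : i = j := by
    by_contra hne
    exact hi' (Finset.mem_erase.mpr ⟨hne, hi⟩)
  subst this
  rw [th_idem x bs hx hbs, sub_self]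

lemma inK_const (hx : ∀ j, x j ≠ 0)
    (hbs : ∀ j, bs j = (x j)⁻¹ • KaehlerDifferential.D ℤ F (x j)) (s : Finset J) (z : F)
    (h : inK bs s z) (hz : ∀ i, th bs i z = 0) : z = 0 := by
  induction s using Finset.induction_on with
  | empty => exact inK_empty bs z h
  | insert i s hi ih =>
    have := inK_proj x bs hx hbs _ i z h
    rw [hz i, sub_zero, Finset.erase_insert hi] at this
    exact ih this

/-- The span of the monomials below `s`. -/
def Lo (s : Finset J) : Submodule F (DF F) :=
  Submodule.span F (eB bs '' {t | toColex t < toColex s})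

lemma mem_Lo (s : Finset J) (w : DF F) :
    w ∈ Lo bs s ↔ ∀ t, (eB bs).repr w t ≠ 0 → toColex t < toColex s := by
  rw [Lo, Module.Basis.mem_span_image]
  constructor
  · intro h t ht
    exact h (by simpa using ht)
  · intro h t ht
    exact h t (by simpa using ht)

lemma eF_mem_Lo {s t : Finset J} (h : toColex t < toColex s) : eF F bs t ∈ Lo bs s :=
  Submodule.subset_span ⟨t, h, by simp⟩

lemma eF_mul_mem_Lo (s t : Finset J) (k : J)
    (h : k ∉ t → toColex (insert k t) < toColex s) :
    eF F bs t * ExteriorAlgebra.ι F (bs k) ∈ Lo bs s := by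
  rw [← ι_comm_eF, ι_mul_eF]
  split_ifs with hk
  · exact Submodule.zero_mem _
  · exact eF_mem_Lo bs (h hk)

lemma dLog_eq (a : F) :
    dLog F a = ExteriorAlgebra.ι F (a⁻¹ • KaehlerDifferential.D ℤ F a) := rfl

lemma kato_build (hx : ∀ j, x j ≠ 0)
    (hbs : ∀ j, bs j = (x j)⁻¹ • KaehlerDifferential.D ℤ F (x j)) (s : Finset J) :
    ∀ y : F, y ≠ 0 → (∀ k, k ∉ s → inK bs (s.filter (k < ·)) (th bs k y)) →
      inK bs s (y ^ 2 - y) →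
    ∃ l : List F, l.length = s.card ∧ (∀ a ∈ l, a ≠ 0) ∧
      (l.map (dLog F)).prod - y • eF F bs s ∈ Lo bs s ∧
      ∀ a, l.head? = some a → ∀ k, th bs k a ≠ 0 → ∀ i ∈ s, k ≤ i := by
  induction s using Finset.induction_on_max with
  | empty =>
    intro y hy _ hB
    have h1 := inK_empty bs _ hB
    have h2 : y = 1 := by
      have : y * (y - 1) = 0 := by linear_combination h1
      rcases mul_eq_zero.mp this with h | h
      · exact absurd h hy
      · exact sub_eq_zero.mp h
    exact ⟨[], by simp, by simp, by simp [h2], by simp⟩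
  | insert j s hjs ih =>
    intro y hy hA hB
    have hj : j ∉ s := fun h => lt_irrefl _ (hjs j h)
    set u := y - th bs j y with hu
    have hthju : th bs j u = 0 := by rw [hu, map_sub, th_idem x bs hx hbs, sub_self]
    have hgt : ∀ k, j < k → th bs k y = 0 := by
      intro k hk
      have hks : k ∉ insert j s := by
        intro h
        rcases Finset.mem_insert.mp h with rfl | h
        · exact lt_irrefl _ hk
        · exact lt_asymm hk (hjs k h)
      have := hA k hks
      rw [Finset.filter_eq_empty_iff.mpr] at this
      · exact inK_empty bs _ this
      · intro i hi hki
        rcases Finset.mem_insert.mp hi with rfl | h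
        · exact lt_asymm hk hki
        · exact lt_asymm (hk.trans hki) (hjs i h)
    have hgtu : ∀ k, j < k → th bs k u = 0 := by
      intro k hk
      rw [hu, map_sub, th_comm x bs hx hbs, hgt k hk, map_zero, sub_zero]
    have hBu : inK bs s (y ^ 2 - u) := by
      have := inK_proj x bs hx hbs _ j _ hB
      rw [Finset.erase_insert hj, map_sub, der_sq] at this
      convert this using 1
      rw [hu]; ring
    have hu0 : u ≠ 0 := by
      intro h
      rw [h, sub_zero] at hBu
      have := inK_const x bs hx hbs _ _ hBu (fun i => der_sq _ _)
      exact hy (pow_eq_zero_iff (two_ne_zero) |>.mp this)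
    have hAu : ∀ k, k ∉ s → inK bs (s.filter (k < ·)) (th bs k u) := by
      intro k hk
      by_cases hkj : k = j
      · rw [hkj, hthju]; exact inK_zero bs _
      · have h1 := inK_proj x bs hx hbs _ j _ (hA k (by simp [hk, hkj]))
        have h2 : ((insert j s).filter (k < ·)).erase j = s.filter (k < ·) := by
          ext i
          simp only [Finset.mem_erase, Finset.mem_filter, Finset.mem_insert]
          constructor
          · rintro ⟨h1, h2 | h2, h3⟩
            · exact absurd h2 h1
            · exact ⟨h2, h3⟩
          · rintro ⟨h1, h2⟩
            exact ⟨fun h => hj (h ▸ h1), Or.inr h1, h2⟩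
        rw [h2, ← th_comm x bs hx hbs, ← map_sub] at h1
        exact h1
    set w := (y / u) ^ 2 * u with hw
    have hw0 : w ≠ 0 := mul_ne_zero (pow_ne_zero _ (div_ne_zero hy hu0)) hu0
    obtain ⟨l, hlen, hne, hlo, hhead⟩ := ih w hw0
      (fun k hk => by rw [hw, th_sq_mul]; exact inK_sq_mul bs _ _ _ (hAu k hk))
      (by
        have : w ^ 2 - w = (y / u) ^ 2 * (y ^ 2 - u) := by
          rw [hw]; field_simp
        rw [this]
        exact inK_sq_mul bs _ _ _ hBu)
    set a := x j * (y * u⁻¹) with ha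
    have ha0 : a ≠ 0 := mul_ne_zero (hx j) (mul_ne_zero hy (inv_ne_zero hu0))
    have htha : ∀ k, th bs k a = x j * (y * (-(u⁻¹) ^ 2 * th bs k u) + u⁻¹ * th bs k y) +
        y * u⁻¹ * th bs k (x j) := by
      intro k
      rw [ha, Derivation.leibniz, Derivation.leibniz, Derivation.leibniz_inv]
      simp only [smul_eq_mul]
    have h2 : (2 : F) = 0 := CharTwo.two_eq_zero
    have hthgt : ∀ k, j < k → th bs k a = 0 := by
      intro k hk
      rw [htha, hgt k hk, hgtu k hk, th_x x bs hx hbs, if_neg hk.ne']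
      simp
    have hthj : th bs j a = x j := by
      rw [htha, hthju, th_x x bs hx hbs, if_pos rfl]
      have : th bs j y = u - y := by rw [hu]; linear_combination (th bs j y) * h2
      rw [this]
      field_simp
      ring
    -- the differential of `a`
    have hspan : a⁻¹ • KaehlerDifferential.D ℤ F a - (u / y) • bs j ∈
        Submodule.span F (bs '' {k | k < j}) := by
      rw [Module.Basis.mem_span_image]
      intro k hk
      by_contra hkj
      apply (Finsupp.mem_support_iff.mp (Finset.mem_coe.mp hk))
      have hkj' : j ≤ k := not_lt.mp hkj
      rw [map_sub, map_smul, map_smul, Finsupp.sub_apply, Finsupp.smul_apply, Finsupp.smul_apply,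
        ← th_apply, Module.Basis.repr_self, Finsupp.single_apply]
      rcases hkj'.eq_or_lt with rfl | hlt
      · rw [hthj, if_pos rfl, ha]
        have := hx j
        simp only [smul_eq_mul]
        field_simp
        ring
      · rw [hthgt k hlt, if_neg hlt.ne]
        simp
    have hle2 : ∀ v ∈ Submodule.span F (bs '' {k | k < j}),
        ∀ t : Finset J, (∀ i ∈ t, i < j) →
        eF F bs t * ExteriorAlgebra.ι F v ∈ Lo bs (insert j s) := by
      intro v hv t ht
      induction hv using Submodule.span_induction with
      | mem v hv =>
        obtain ⟨k, hk, rfl⟩ := hv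
        refine eF_mul_mem_Lo bs _ _ _ (fun _ => ?_)
        refine colex_lt_of_forall_lt (j := j) ?_ (by simp)
        intro i hi
        rcases Finset.mem_insert.mp hi with rfl | hi
        · exact hk
        · exact ht i hi
      | zero => simp
      | add a b _ _ ha hb => rw [map_add, mul_add]; exact Submodule.add_mem _ ha hb
      | smul c a _ ha => rw [map_smul, mul_smul_comm]; exact Submodule.smul_mem _ _ ha
    have hdec : dLog F a = ExteriorAlgebra.ι F
        (a⁻¹ • KaehlerDifferential.D ℤ F a - (u / y) • bs j) +
        (u / y) • ExteriorAlgebra.ι F (bs j) := by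
      rw [dLog_eq, map_sub, map_smul ((ExteriorAlgebra.ι F)) (u / y), sub_add_cancel]
    have hlow : ∀ p ∈ Lo bs s, p * dLog F a ∈ Lo bs (insert j s) := by
      intro p hp
      unfold Lo at hp
      induction hp using Submodule.span_induction with
      | mem p hp =>
        obtain ⟨t, ht, rfl⟩ := hp
        have htj : ∀ i ∈ t, i < j := Finset.Colex.forall_lt_mono (le_of_lt ht) hjs
        rw [eB_apply, hdec, mul_add, mul_smul_comm]
        refine Submodule.add_mem _ (hle2 _ hspan t htj) (Submodule.smul_mem _ _ ?_)
        exact eF_mul_mem_Lo bs _ _ _ (fun hjt => colex_insert_lt hjt hj ht)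
      | zero => simp
      | add a b _ _ ha hb => rw [add_mul]; exact Submodule.add_mem _ ha hb
      | smul c a _ ha => rw [smul_mul_assoc]; exact Submodule.smul_mem _ _ ha
    refine ⟨l ++ [a], ?_, ?_, ?_, ?_⟩
    · simp [hlen, Finset.card_insert_of_notMem hj]
    · intro c hc
      rcases List.mem_append.mp hc with hc | hc
      · exact hne c hc
      · rw [List.mem_singleton.mp hc]; exact ha0
    · have hprod : ((l ++ [a]).map (dLog F)).prod = (l.map (dLog F)).prod * dLog F a := by simp
      have hwu : w * (u / y) = y := by rw [hw]; field_simp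
      have : ((l ++ [a]).map (dLog F)).prod - y • eF F bs (insert j s) =
          ((l.map (dLog F)).prod - w • eF F bs s) * dLog F a +
          w • (eF F bs s * ExteriorAlgebra.ι F
            (a⁻¹ • KaehlerDifferential.D ℤ F a - (u / y) • bs j)) := by
        have e1 : w • (eF F bs s * ExteriorAlgebra.ι F
            (a⁻¹ • KaehlerDifferential.D ℤ F a - (u / y) • bs j)) =
            w • (eF F bs s * dLog F a) - y • eF F bs (insert j s) := by
          rw [hdec, mul_add, smul_add, mul_smul_comm, smul_smul, hwu, eF_insert' _ _ _ hj,
            add_sub_cancel_right]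
        rw [e1, hprod, sub_mul, smul_mul_assoc]
        abel
      rw [this]
      exact Submodule.add_mem _ (hlow _ hlo) (Submodule.smul_mem _ _ (hle2 _ hspan s hjs))
    · intro c hc k hk i hi
      rcases l with _ | ⟨c', l'⟩
      · have hs : s = ∅ := by
          rw [← Finset.card_eq_zero, ← hlen]; rfl
        simp only [List.nil_append, List.head?_cons, Option.some.injEq] at hc
        subst hc
        rw [hs] at hi
        simp only [Finset.mem_insert, Finset.notMem_empty, or_false] at hi
        rw [hi]
        by_contra hkj
        exact hk (hthgt k (not_le.mp hkj))
      · simp only [List.cons_append, List.head?_cons, Option.some.injEq] at hc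
        subst hc
        have hall := hhead c' rfl k hk
        rcases Finset.mem_insert.mp hi with rfl | hi
        · have hsne : s.Nonempty := by
            rw [← Finset.card_pos, ← hlen]; simp
          obtain ⟨i', hi'⟩ := hsne
          exact (hall i' hi').trans (hjs i' hi').le
        · exact hall i hi

end Kato

set_option linter.unusedSectionVars false

/-! ### Part 6: the operators `d` and `s_2` in coordinates -/

section DS
variable {F : Type*} [Field F] [CharP F 2] (S : DiffStr 2 F)

lemma dLog_smul (a : F) : dLog F a = a⁻¹ • dForm F a := by
  rw [dLog, dForm, map_smul]

lemma d_dForm_mul (a : F) (w : DF F) : S.d (dForm F a * w) = dForm F a * S.d w := by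
  have h := S.d_d (a • w)
  rw [S.d_smul, map_add, S.d_smul, S.d_d, smul_zero, add_zero] at h
  rw [eq_neg_of_add_eq_zero_left h, ext_neg]

lemma d_dLog_mul (a : F) (w : DF F) : S.d (dLog F a * w) = dLog F a * S.d w := by
  rw [dLog_smul, smul_mul_assoc, S.d_smul, d_dForm_mul, smul_mul_assoc, ← mul_assoc]
  have : dForm F a⁻¹ * dForm F a = 0 := by
    rw [dForm, dForm, Derivation.leibniz_inv, map_smul, smul_mul_assoc,
      ExteriorAlgebra.ι_sq_zero, smul_zero]
  rw [this, zero_mul, zero_add]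

lemma logForm_succ {n : ℕ} (f : Fin (n + 1) → F) :
    logForm F f = dLog F (f 0) * logForm F (fun i => f i.succ) := by
  simp [logForm, List.ofFn_succ]

lemma logForm_cons {n : ℕ} (u : F) (f : Fin n → F) :
    logForm F (Fin.cons u f : Fin (n + 1) → F) = dLog F u * logForm F f := by
  rw [logForm_succ]; simp

lemma logForm_zero (f : Fin 0 → F) : logForm F f = 1 := by simp [logForm]

lemma exists_logForm (l : List F) (n : ℕ) (h : l.length = n) :
    ∃ f : Fin n → F, (l.map (dLog F)).prod = logForm F f := by
  subst h
  refine ⟨fun i => l.get i, ?_⟩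
  rw [logForm]
  congr 1
  have := List.map_ofFn (f := fun i => l.get i) (g := dLog F)
  rw [List.ofFn_get] at this
  exact this

lemma dLog_mul_mem {n : ℕ} (u : F) (w : DF F) (h : w ∈ omegaPow F n) :
    dLog F u * w ∈ omegaPow F (n + 1) := by
  rw [omegaPow, pow_succ']
  exact Submodule.mul_mem_mul ⟨_, rfl⟩ h

lemma logForm_mem {n : ℕ} (f : Fin n → F) : logForm F f ∈ omegaPow F n := by
  induction n with
  | zero =>
    rw [logForm_zero, omegaPow, pow_zero]
    exact Submodule.one_le.mp le_rfl
  | succ n ih =>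
    rw [logForm_succ]
    exact dLog_mul_mem _ _ (ih _)

lemma dLog_mul_mem_pred {n : ℕ} (u : F) (w : DF F) (h : w ∈ omegaPred F n) :
    dLog F u * w ∈ omegaPow F n := by
  cases n with
  | zero =>
    have : w = 0 := by simpa [omegaPred] using h
    rw [this, mul_zero]; exact Submodule.zero_mem _
  | succ n => exact dLog_mul_mem _ _ h

variable {J : Type*} [LinearOrder J]
variable (x : J → F) (bs : Module.Basis J F (KaehlerDifferential ℤ F))

lemma ι_bs (hbs : ∀ j, bs j = (x j)⁻¹ • KaehlerDifferential.D ℤ F (x j)) (j : J) :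
    ExteriorAlgebra.ι F (bs j) = dLog F (x j) := by rw [hbs]; rfl

lemma d_eF (hbs : ∀ j, bs j = (x j)⁻¹ • KaehlerDifferential.D ℤ F (x j)) (s : Finset J) :
    S.d (eF F bs s) = 0 := by
  induction s using Finset.induction_on with
  | empty => rw [eF_empty, S.d_one]
  | insert j s hj ih => rw [eF_insert _ _ _ hj, ι_bs x bs hbs, d_dLog_mul, ih, mul_zero]

lemma eF_logForm (hbs : ∀ j, bs j = (x j)⁻¹ • KaehlerDifferential.D ℤ F (x j)) (s : Finset J)
    (n : ℕ) (hs : s.card = n) : ∃ f : Fin n → F, eF F bs s = logForm F f := by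
  induction s using Finset.induction_on generalizing n with
  | empty =>
    subst hs
    exact ⟨fun i => 0, by simp [logForm]⟩
  | insert j s hj ih =>
    rw [Finset.card_insert_of_notMem hj] at hs
    subst hs
    obtain ⟨f, hf⟩ := ih _ rfl
    exact ⟨Fin.cons (x j) f, by rw [eF_insert _ _ _ hj, ι_bs x bs hbs, hf, logForm_cons]⟩

lemma d_repr (hbs : ∀ j, bs j = (x j)⁻¹ • KaehlerDifferential.D ℤ F (x j)) (w : DF F)
    (s : Finset J) : (eB bs).repr (S.d w) s =
      ∑ i ∈ s, th bs i ((eB bs).repr w (s.erase i)) := by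
  suffices h : ∀ c : F, (eB bs).repr (S.d (c • w)) s =
      ∑ i ∈ s, th bs i ((eB bs).repr (c • w) (s.erase i)) by
    simpa using h 1
  induction w using basis_ind (eB bs) with
  | zero => simp
  | add a b ha hb =>
    intro c
    rw [smul_add, map_add, map_add, map_add, Finsupp.add_apply, ha, hb, ← Finset.sum_add_distrib]
    simp only [Finsupp.add_apply, map_add]
  | smul e a ha =>
    intro c
    rw [smul_smul]
    exact ha _
  | basis t =>
    intro c
    rw [eB_apply, S.d_smul, d_eF S x bs hbs, smul_zero, add_zero, dForm, eB_repr_ι_mul]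
    refine Finset.sum_congr rfl fun i _ => ?_
    rw [map_smul, Finsupp.smul_apply, eB_repr_eF, ← th_apply]
    split_ifs <;> simp

lemma sp_repr (hbs : ∀ j, bs j = (x j)⁻¹ • KaehlerDifferential.D ℤ F (x j)) (w : DF F) :
    ∃ z : DF F, ∀ s : Finset J, (eB bs).repr (S.sp w) s =
      ((eB bs).repr w s) ^ 2 + (eB bs).repr (S.d z) s := by
  suffices h : ∀ c : F, ∃ z : DF F, ∀ s : Finset J, (eB bs).repr (S.sp (c • w)) s =
      ((eB bs).repr (c • w) s) ^ 2 + (eB bs).repr (S.d z) s by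
    simpa using h 1
  induction w using basis_ind (eB bs) with
  | zero => exact fun c => ⟨0, by simp⟩
  | add a b ha hb =>
    intro c
    obtain ⟨z₁, h₁⟩ := ha c
    obtain ⟨z₂, h₂⟩ := hb c
    refine ⟨z₁ + z₂, fun s => ?_⟩
    rw [smul_add, map_add, map_add, map_add, map_add, map_add, Finsupp.add_apply,
      Finsupp.add_apply, Finsupp.add_apply, h₁, h₂, CharTwo.add_sq]
    ring
  | smul e a ha =>
    intro c
    rw [smul_smul]
    exact ha _
  | basis t =>
    intro c
    obtain ⟨f, hf⟩ := eF_logForm x bs hbs t _ rfl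
    obtain ⟨z, -, hz⟩ := S.sp_log _ c f
    refine ⟨z, fun s => ?_⟩
    rw [eB_apply, hf, hz, ← hf, map_add, Finsupp.add_apply, map_smul, map_smul,
      Finsupp.smul_apply, Finsupp.smul_apply, eB_repr_eF]
    split_ifs <;> simp

lemma nu_repr (hbs : ∀ j, bs j = (x j)⁻¹ • KaehlerDifferential.D ℤ F (x j)) (n : ℕ) (w : DF F)
    (hw : w ∈ nuSet S n) : ∃ z : DF F, ∀ s : Finset J,
      (eB bs).repr (S.d z) s = ((eB bs).repr w s) ^ 2 - (eB bs).repr w s := by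
  obtain ⟨-, z₁, -, h₁⟩ := hw
  obtain ⟨z₂, h₂⟩ := sp_repr S x bs hbs w
  refine ⟨z₁ - z₂, fun s => ?_⟩
  rw [map_sub, ← h₁, map_sub, map_sub, Finsupp.sub_apply, Finsupp.sub_apply, h₂]
  ring

lemma kato_hyp (hbs : ∀ j, bs j = (x j)⁻¹ • KaehlerDifferential.D ℤ F (x j)) (n : ℕ) (w : DF F)
    (hw : w ∈ nuSet S n) (s : Finset J)
    (hmax : ∀ t, (eB bs).repr w t ≠ 0 → toColex t ≤ toColex s) :
    (∀ k, k ∉ s → inK bs (s.filter (k < ·)) (th bs k ((eB bs).repr w s))) ∧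
      inK bs s (((eB bs).repr w s) ^ 2 - (eB bs).repr w s) := by
  obtain ⟨z, hz⟩ := nu_repr S x bs hbs n w hw
  constructor
  · intro k hk
    have h0 : (eB bs).repr (S.d (S.d z)) (insert k s) = 0 := by rw [S.d_d]; simp
    have hth : ∀ i (c : F), th bs i (c ^ 2 - c) = - th bs i c := by
      intro i c
      rw [map_sub, der_sq, zero_sub]
    rw [d_repr S x bs hbs, Finset.sum_insert hk, Finset.erase_insert hk] at h0
    simp only [hz, hth] at h0
    refine ⟨fun i => - (eB bs).repr w ((insert k s).erase i), ?_⟩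
    have h1 : ∑ i ∈ s.filter (k < ·), th bs i (- (eB bs).repr w ((insert k s).erase i)) =
        ∑ i ∈ s, - th bs i ((eB bs).repr w ((insert k s).erase i)) := by
      rw [Finset.sum_filter]
      refine Finset.sum_congr rfl fun i hi => ?_
      split_ifs with hki
      · rw [map_neg]
      · have hik : i < k := lt_of_le_of_ne (not_lt.mp hki) (fun h => hk (h ▸ hi))
        have : (eB bs).repr w ((insert k s).erase i) = 0 := by
          by_contra hne
          exact absurd (colex_swap_lt hk hi hik) (not_lt.mpr (hmax _ hne))
        rw [this, map_zero, neg_zero]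
    rw [h1]
    linear_combination -h0
  · exact ⟨fun i => (eB bs).repr z (s.erase i), by rw [← hz, d_repr S x bs hbs]⟩

lemma omegaPow_repr (n : ℕ) (w : DF F) (hw : w ∈ omegaPow F n) (s : Finset J)
    (hs : (eB bs).repr w s ≠ 0) : s.card = n := by
  induction n generalizing w s with
  | zero =>
    rw [omegaPow, pow_zero, Submodule.mem_one] at hw
    obtain ⟨c, rfl⟩ := hw
    rw [Algebra.algebraMap_eq_smul_one, ← eF_empty (K := F) (bs : J → _), map_smul,
      Finsupp.smul_apply, eB_repr_eF] at hs
    by_contra hne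
    apply hs
    rw [if_neg (fun h => hne (by rw [← h]; rfl)), smul_zero]
  | succ n ih =>
    rw [omegaPow, pow_succ'] at hw
    induction hw using Submodule.mul_induction_on' with
    | mem_mul_mem a ha c hc =>
      obtain ⟨v, rfl⟩ := ha
      rw [eB_repr_ι_mul] at hs
      obtain ⟨i, hi, hne⟩ := Finset.exists_ne_zero_of_sum_ne_zero hs
      have := ih c hc (s.erase i) (right_ne_zero_of_mul hne)
      rw [← Finset.card_erase_add_one hi, this]
    | add a _ c _ ha hc =>
      rw [map_add, Finsupp.add_apply] at hs
      by_cases h : (eB bs).repr a s = 0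
      · rw [h, zero_add] at hs; exact hc hs
      · exact ha h

lemma omegaPow_ind (hbs : ∀ j, bs j = (x j)⁻¹ • KaehlerDifferential.D ℤ F (x j)) (n : ℕ)
    {p : DF F → Prop} (h0 : p 0) (hadd : ∀ a c, p a → p c → p (a + c))
    (hlog : ∀ (a : F) (f : Fin n → F), p (a • logForm F f)) (w : DF F) (hw : w ∈ omegaPow F n) :
    p w := by
  rw [← (eB bs).linearCombination_repr w, Finsupp.linearCombination_apply, Finsupp.sum]
  apply Finset.sum_induction _ p hadd h0
  intro s hs
  obtain ⟨f, hf⟩ := eF_logForm x bs hbs s n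
    (omegaPow_repr bs n w hw s (Finsupp.mem_support_iff.mp hs))
  rw [eB_apply, hf]
  exact hlog _ _

/-- `ν_n(F)` as a group. -/
def nuGrp (n : ℕ) : AddSubgroup (DF F) where
  carrier := nuSet S n
  zero_mem' := ⟨Submodule.zero_mem _, 0, Submodule.zero_mem _, by simp⟩
  add_mem' := by
    rintro a c ⟨ha, z, hz, h1⟩ ⟨hc, z', hz', h2⟩
    refine ⟨Submodule.add_mem _ ha hc, z + z', Submodule.add_mem _ hz hz', ?_⟩
    rw [map_add, map_add, ← h1, ← h2]; abel
  neg_mem' := by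
    rintro a ⟨ha, z, hz, h1⟩
    refine ⟨Submodule.neg_mem _ ha, -z, Submodule.neg_mem _ hz, ?_⟩
    rw [map_neg, map_neg, ← h1]; abel

lemma mem_nuGrp (n : ℕ) (w : DF F) : w ∈ nuGrp S n ↔ w ∈ nuSet S n := Iff.rfl

lemma logForm_mem_nu (n : ℕ) (f : Fin n → F) : logForm F f ∈ nuSet S n := by
  obtain ⟨z, hz, h⟩ := S.sp_log n 1 f
  refine ⟨logForm_mem f, z, hz, ?_⟩
  rw [one_smul, one_pow, one_smul] at h
  rw [h, add_sub_cancel_left]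

lemma sp_dLog_mul (hbs : ∀ j, bs j = (x j)⁻¹ • KaehlerDifferential.D ℤ F (x j)) (n : ℕ) (u : F)
    (w : DF F) (hw : w ∈ omegaPow F n) :
    ∃ z ∈ omegaPow F n, S.sp (dLog F u * w) = dLog F u * S.sp w + S.d z := by
  refine omegaPow_ind x bs hbs n (p := fun w => ∃ z ∈ omegaPow F n,
    S.sp (dLog F u * w) = dLog F u * S.sp w + S.d z) ?_ ?_ ?_ w hw
  · exact ⟨0, Submodule.zero_mem _, by simp⟩
  · intro a c ha hc
    obtain ⟨z, hz, h1⟩ := ha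
    obtain ⟨z', hz', h2⟩ := hc
    refine ⟨z + z', Submodule.add_mem _ hz hz', ?_⟩
    rw [mul_add, map_add, map_add, map_add, h1, h2, mul_add]; abel
  · intro a f
    obtain ⟨z, hz, h1⟩ := S.sp_log _ a (Fin.cons u f : Fin (n + 1) → F)
    obtain ⟨z', hz', h2⟩ := S.sp_log _ a f
    refine ⟨z - dLog F u * z', Submodule.sub_mem _ hz (dLog_mul_mem_pred _ _ hz'), ?_⟩
    rw [logForm_cons] at h1
    rw [mul_smul_comm, h1, h2, map_sub, d_dLog_mul, mul_add, mul_smul_comm]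
    abel

lemma dLog_mul_mem_nu (hbs : ∀ j, bs j = (x j)⁻¹ • KaehlerDifferential.D ℤ F (x j)) (n : ℕ)
    (u : F) (w : DF F) (hw : w ∈ nuSet S n) : dLog F u * w ∈ nuSet S (n + 1) := by
  obtain ⟨h1, z, hz, h2⟩ := hw
  obtain ⟨z', hz', h3⟩ := sp_dLog_mul S x bs hbs n u w h1
  refine ⟨dLog_mul_mem u w h1, dLog F u * z + z',
    Submodule.add_mem _ (dLog_mul_mem_pred _ _ hz) hz', ?_⟩
  rw [map_add, d_dLog_mul, ← h2, h3, mul_sub]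
  abel

lemma dLog_mem_nu (u : F) : dLog F u ∈ nuSet S 1 := by
  have := logForm_mem_nu S 1 (fun _ => u)
  rwa [logForm_succ, logForm_zero, mul_one] at this

end DS

section RS
variable {F E : Type*} [Field F] [Field E] [Algebra F E] [CharP F 2] [CharP E 2]
variable {SF : DiffStr 2 F} {SE : DiffStr 2 E} (R : DiffRes 2 F E SF SE)

lemma res_dLog (a : F) : R.res (dLog F a) = dLog E (algebraMap F E a) := by
  rw [dLog_smul, R.res_smul, R.res_dForm, dLog_smul, map_inv₀]

lemma res_dLog_zero {r : ℕ} (b : Fin r → F) (m : Fin r → ℕ) (hm : ∀ i, 1 ≤ m i)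
    (β : Fin r → E) (hβ : ∀ i, β i ^ 2 ^ m i = algebraMap F E (b i))
    (u : F) (hu : u ∈ sqSubfield b) : R.res (dLog F u) = 0 := by
  rw [res_dLog, dLog, D_E_zero b m hm β hβ u hu, smul_zero, map_zero]

variable {J : Type*} [LinearOrder J]
variable (x : J → F) (bs : Module.Basis J F (KaehlerDifferential ℤ F))

lemma res_eF (hbs : ∀ j, bs j = (x j)⁻¹ • KaehlerDifferential.D ℤ F (x j)) (s : Finset J) :
    R.res (eF F bs s) = eF E (fun j => (algebraMap F E (x j))⁻¹ •
      KaehlerDifferential.D ℤ E (algebraMap F E (x j))) s := by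
  induction s using Finset.induction_on with
  | empty => rw [eF_empty, eF_empty, R.res_one]
  | insert j s hj ih =>
    rw [eF_insert _ _ _ hj, eF_insert _ _ _ hj, ι_bs x bs hbs, R.res_mul, res_dLog, ih]
    rfl

lemma repr_eq_zero_of_res {r : ℕ} (b : Fin r → F) (k : Fin r → J) (hx : ∀ j, x j ≠ 0)
    (hbs : ∀ j, bs j = (x j)⁻¹ • KaehlerDifferential.D ℤ F (x j))
    (hk : ∀ i, x (k i) = b i) (hkinj : Function.Injective k)
    (m : Fin r → ℕ) (β : Fin r → E) (hβ : ∀ i, β i ^ 2 ^ m i = algebraMap F E (b i))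
    (hgen : Algebra.adjoin F (Set.range β) = ⊤) (w : DF F) (hw : R.res w = 0) (t : Finset J)
    (ht : ∀ i ∈ t, i ∉ Set.range k) : (eB bs).repr w t = 0 := by
  have hd := fun i hi => exists_dual_E x bs b k hx hbs hk hkinj i hi m β hβ hgen
  choose! f hf using hd
  obtain ⟨g, hg⟩ := exists_coef (fun j => (algebraMap F E (x j))⁻¹ •
      KaehlerDifferential.D ℤ E (algebraMap F E (x j))) f t (fun i hi j => hf i (ht i hi) j)
  have key : ∀ c : F, g (R.res (c • w)) = algebraMap F E ((eB bs).repr (c • w) t) := by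
    clear hw
    induction w using basis_ind (eB bs) with
    | zero => simp
    | add a b ha hb =>
      intro c
      rw [smul_add, map_add, map_add, ha, hb, map_add, Finsupp.add_apply, map_add]
    | smul e a ha =>
      intro c
      rw [smul_smul]
      exact ha _
    | basis s =>
      intro c
      rw [eB_apply, R.res_smul, res_eF R x bs hbs, map_smul, hg, map_smul, Finsupp.smul_apply,
        eB_repr_eF]
      split_ifs <;> simp
  have := key 1
  rw [one_smul, hw, map_zero] at this
  exact (map_eq_zero _).mp this.symm

/-- The generators of the kernel. -/
def kerGen {F : Type*} [Field F] {r : ℕ} (b : Fin r → F) (n : ℕ) : Set (DF F) :=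
  {z | ∃ (a : F) (f : Fin n → F), a ∈ sqSubfield b ∧ a ≠ 0 ∧ z = dLog F a * logForm F f}

lemma main_step {r : ℕ} (b : Fin r → F) (k : Fin r → J) (hx : ∀ j, x j ≠ 0)
    (hbs : ∀ j, bs j = (x j)⁻¹ • KaehlerDifferential.D ℤ F (x j))
    (hk : ∀ i, x (k i) = b i) (hkinj : Function.Injective k)
    (hinit : ∀ j i, j ≤ k i → j ∈ Set.range k)
    (m : Fin r → ℕ) (β : Fin r → E) (hβ : ∀ i, β i ^ 2 ^ m i = algebraMap F E (b i))
    (hgen : Algebra.adjoin F (Set.range β) = ⊤) (n : ℕ) (w : DF F)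
    (hw : w ∈ nuSet SF (n + 1)) (hres : R.res w = 0) (s : Finset J)
    (hs : (eB bs).repr w s ≠ 0)
    (hmax : ∀ t, (eB bs).repr w t ≠ 0 → toColex t ≤ toColex s) :
    ∃ z ∈ kerGen b n, ∀ t, (eB bs).repr (w - z) t ≠ 0 → toColex t < toColex s := by
  obtain ⟨hA, hB⟩ := kato_hyp SF x bs hbs _ w hw s hmax
  obtain ⟨l, hlen, hne, hlo, hhead⟩ := kato_build x bs hx hbs s _ hs hA hB
  have hcard := omegaPow_repr bs _ w hw.1 s hs
  have hmeet : ∃ i ∈ s, i ∈ Set.range k := by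
    by_contra hcon
    push Not at hcon
    exact hs (repr_eq_zero_of_res R x bs b k hx hbs hk hkinj m β hβ hgen w hres s hcon)
  obtain ⟨_, hi, i, rfl⟩ := hmeet
  rcases l with _ | ⟨a, l'⟩
  · rw [hcard] at hlen; simp at hlen
  · obtain ⟨f, hf⟩ := exists_logForm l' n (by
      rw [hcard] at hlen; simpa using hlen)
    have hprod : ((a :: l').map (dLog F)).prod = dLog F a * logForm F f := by
      rw [List.map_cons, List.prod_cons, hf]
    have ha : a ∈ sqSubfield b := by
      apply mem_sqAdj_of_D_mem_span (Set.range b) a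
      rw [← bs.linearCombination_repr (KaehlerDifferential.D ℤ F a),
        Finsupp.linearCombination_apply, Finsupp.sum]
      refine Submodule.sum_mem _ fun j hj => Submodule.smul_mem _ _ ?_
      obtain ⟨i', hi'⟩ := hinit j i
        (hhead a rfl j (Finsupp.mem_support_iff.mp hj) _ hi)
      rw [hbs]
      refine Submodule.smul_mem _ _ (Submodule.subset_span ⟨x j, ⟨i', ?_⟩, rfl⟩)
      rw [← hi', hk]
    refine ⟨dLog F a * logForm F f, ⟨a, f, ha, hne a (by simp), rfl⟩, ?_⟩
    intro t ht
    rw [hprod, mem_Lo] at hlo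
    rw [map_sub, Finsupp.sub_apply] at ht
    have hlo' := hlo t
    rw [map_sub, map_smul, Finsupp.sub_apply, Finsupp.smul_apply, eB_repr_eF] at hlo'
    by_cases hst : s = t
    · subst hst
      refine absurd (hlo' ?_) (lt_irrefl _)
      rw [if_pos rfl, smul_eq_mul, mul_one, ← neg_sub]
      exact neg_ne_zero.mpr ht
    · rw [if_neg hst, smul_zero, sub_zero] at hlo'
      by_cases h1 : (eB bs).repr (dLog F a * logForm F f) t = 0
      · rw [h1, sub_zero] at ht
        exact lt_of_le_of_ne (hmax t ht) (fun h => hst (by simpa using h.symm))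
      · exact hlo' h1

lemma main_ind [WellFoundedLT J] {r : ℕ} (b : Fin r → F) (k : Fin r → J) (hx : ∀ j, x j ≠ 0)
    (hbs : ∀ j, bs j = (x j)⁻¹ • KaehlerDifferential.D ℤ F (x j))
    (hk : ∀ i, x (k i) = b i) (hkinj : Function.Injective k)
    (hinit : ∀ j i, j ≤ k i → j ∈ Set.range k)
    (m : Fin r → ℕ) (hm : ∀ i, 1 ≤ m i)
    (β : Fin r → E) (hβ : ∀ i, β i ^ 2 ^ m i = algebraMap F E (b i))
    (hgen : Algebra.adjoin F (Set.range β) = ⊤) (n : ℕ) (w : DF F)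
    (hw : w ∈ nuSet SF (n + 1)) (hres : R.res w = 0) :
    w ∈ AddSubgroup.closure (kerGen b n) := by
  have hmaxS : ∀ w : DF F, w ≠ 0 → ∃ s : Finset J, (eB bs).repr w s ≠ 0 ∧
      ∀ t, (eB bs).repr w t ≠ 0 → toColex t ≤ toColex s := by
    intro w hw0
    have hne : ((eB bs).repr w).support.Nonempty := by
      rw [Finsupp.support_nonempty_iff]
      simpa using hw0
    obtain ⟨s, hs, hmax⟩ := Finset.exists_max_image _ (fun t => toColex t) hne
    exact ⟨s, Finsupp.mem_support_iff.mp hs, fun t ht => hmax t (Finsupp.mem_support_iff.mpr ht)⟩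
  have key : ∀ T : Colex (Finset J), Acc (· < ·) T → ∀ w : DF F, w ∈ nuSet SF (n + 1) →
      R.res w = 0 → ∀ s : Finset J, toColex s = T → (eB bs).repr w s ≠ 0 →
      (∀ t, (eB bs).repr w t ≠ 0 → toColex t ≤ toColex s) →
      w ∈ AddSubgroup.closure (kerGen b n) := by
    intro T hT
    induction hT with
    | intro T _ ih =>
      intro w hw hres s hsT hs hmax
      obtain ⟨z, hz, hlt⟩ := main_step R x bs b k hx hbs hk hkinj hinit m β hβ hgen n w hw hres
        s hs hmax
      have hzc : z ∈ AddSubgroup.closure (kerGen b n) := AddSubgroup.subset_closure hz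
      suffices h : w - z ∈ AddSubgroup.closure (kerGen b n) by
        have := add_mem h hzc
        rwa [sub_add_cancel] at this
      by_cases h0 : w - z = 0
      · rw [h0]; exact zero_mem _
      · obtain ⟨s', hs', hmax'⟩ := hmaxS _ h0
        obtain ⟨a, f, ha, ha0, rfl⟩ := hz
        refine ih (toColex s') (hsT ▸ hlt s' hs') _ ?_ ?_ s' rfl hs' hmax'
        · exact (nuGrp SF (n + 1)).sub_mem hw
            (dLog_mul_mem_nu SF x bs hbs n a _ (logForm_mem_nu SF n f))
        · rw [map_sub, hres, R.res_mul, res_dLog_zero R b m hm β hβ a ha, zero_mul, sub_zero]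
  by_cases h0 : w = 0
  · rw [h0]; exact zero_mem _
  · obtain ⟨s, hs, hmax⟩ := hmaxS w h0
    exact key _ (colex_wf s) w hw hres s rfl hs hmax

end RS

section Fin
variable {F : Type*} [Field F]

lemma dLog_mul (u v : F) (hu : u ≠ 0) (hv : v ≠ 0) : dLog F (u * v) = dLog F u + dLog F v := by
  rw [dLog, dLog, dLog, ← map_add, Derivation.leibniz, smul_add, smul_smul, smul_smul, add_comm]
  congr 3 <;> field_simp

lemma dLog_one : dLog F 1 = 0 := by simp [dLog]

lemma dLog_inv (u : F) (hu : u ≠ 0) : dLog F u⁻¹ = - dLog F u := by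
  have := dLog_mul u u⁻¹ hu (inv_ne_zero hu)
  rw [mul_inv_cancel₀ hu, dLog_one] at this
  exact (neg_eq_of_add_eq_zero_right this.symm).symm

lemma closure_dLog {r : ℕ} (b : Fin r → F) (w : DF F)
    (hw : w ∈ AddSubgroup.closure (kerGen b 0)) :
    ∃ u : F, u ∈ sqSubfield b ∧ u ≠ 0 ∧ w = dLog F u := by
  induction hw using AddSubgroup.closure_induction with
  | mem z hz =>
    obtain ⟨a, f, ha, ha0, rfl⟩ := hz
    exact ⟨a, ha, ha0, by simp [logForm]⟩
  | zero => exact ⟨1, one_mem _, one_ne_zero, dLog_one.symm⟩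
  | add p q _ _ hp hq =>
    obtain ⟨u, hu, hu0, rfl⟩ := hp
    obtain ⟨v, hv, hv0, rfl⟩ := hq
    exact ⟨u * v, mul_mem hu hv, mul_ne_zero hu0 hv0, (dLog_mul u v hu0 hv0).symm⟩
  | neg p _ hp =>
    obtain ⟨u, hu, hu0, rfl⟩ := hp
    exact ⟨u⁻¹, inv_mem hu, inv_ne_zero hu0, (dLog_inv u hu0).symm⟩

end Fin

/-- **Theorem 63.** Let `F` have characteristic 2 and let
`E = F(b₁^{1/2^{m₁}},…,b_r^{1/2^{m_r}})` be purely inseparable with 2-independent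
`b₁,…,b_r ∈ F` and `mᵢ ≥ 1`. Then `ν_1(E/F) = { dx/x : x ∈ F²(b₁,…,b_r)^* }` (in
particular this set is already a group), and `ν_n(E/F) = ν_1(E/F) ∧ ν_{n-1}(F)` for all
`n ≥ 1` (below: degree `n+1`). -/
theorem nuKernel_purely_inseparable
    (F E : Type*) [Field F] [Field E] [Algebra F E] [CharP F 2] [CharP E 2]
    (SF : DiffStr 2 F) (SE : DiffStr 2 E) (R : DiffRes 2 F E SF SE)
    (r : ℕ) (b : Fin r → F) (m : Fin r → ℕ)
    (hb : TwoIndep b) (hm : ∀ i, 1 ≤ m i)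
    (β : Fin r → E) (hβ : ∀ i, β i ^ 2 ^ m i = algebraMap F E (b i))
    (hgen : Algebra.adjoin F (Set.range β) = ⊤) :
    (∀ ω : DF F, (ω ∈ nuSet SF 1 ∧ R.res ω = 0) ↔
        ∃ u : F, u ∈ sqSubfield b ∧ u ≠ 0 ∧ ω = dLog F u) ∧
    (∀ n : ℕ, ∀ ω : DF F, (ω ∈ nuSet SF (n + 1) ∧ R.res ω = 0) ↔
        ω ∈ AddSubgroup.closure
          { x | ∃ u η : DF F, (u ∈ nuSet SF 1 ∧ R.res u = 0) ∧ η ∈ nuSet SF n ∧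
              x = u * η }) := by
  obtain ⟨J, _, _, x, bs, k, hx, hbs, hk, hkinj, hinit⟩ := exists_adapted_basis hb
  have hmain := fun n w hw hres => main_ind R x bs b k hx hbs hk hkinj hinit m hm β hβ hgen n w
    hw hres
  have part1 : ∀ ω : DF F, (ω ∈ nuSet SF 1 ∧ R.res ω = 0) ↔
      ∃ u : F, u ∈ sqSubfield b ∧ u ≠ 0 ∧ ω = dLog F u := by
    intro ω
    constructor
    · rintro ⟨h1, h2⟩
      exact closure_dLog b ω (hmain 0 ω h1 h2)
    · rintro ⟨u, hu, hu0, rfl⟩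
      exact ⟨dLog_mem_nu SF u, res_dLog_zero R b m hm β hβ u hu⟩
  refine ⟨part1, fun n ω => ⟨?_, ?_⟩⟩
  · rintro ⟨h1, h2⟩
    refine AddSubgroup.closure_mono ?_ (hmain n ω h1 h2)
    rintro _ ⟨a, f, ha, ha0, rfl⟩
    exact ⟨dLog F a, logForm F f, (part1 _).mpr ⟨a, ha, ha0, rfl⟩, logForm_mem_nu SF n f, rfl⟩
  · intro h
    induction h using AddSubgroup.closure_induction with
    | mem z hz =>
      obtain ⟨u, η, hu, hη, rfl⟩ := hz
      obtain ⟨a, ha, ha0, rfl⟩ := (part1 u).mp hu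
      exact ⟨dLog_mul_mem_nu SF x bs hbs n a η hη, by rw [R.res_mul, hu.2, zero_mul]⟩
    | zero => exact ⟨(nuGrp SF (n + 1)).zero_mem, map_zero _⟩
    | add p q _ _ hp hq =>
      exact ⟨(nuGrp SF (n + 1)).add_mem hp.1 hq.1, by rw [map_add, hp.2, hq.2, add_zero]⟩
    | neg p _ hp =>
      exact ⟨(nuGrp SF (n + 1)).neg_mem hp.1, by rw [map_neg, hp.2, neg_zero]⟩
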